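/- arXiv:0706.3472 — 3 statements merged into one kernel-verified Lean document; each statement's English description precedes it below -/
import Mathlib

section
/- Let 𝒜 be an indexing collection on a locally compact metric space T with Radon measure m, and let X and Y be additive 𝒜-indexed stochastic processes. Then X and Y have the same finite-dimensional distributions if and only if for every simple flow f : [a,b] → 𝒜(u) the projected real-parameter processes X^f = {X_{f(t)} : t ∈ [a,b]} and Y^f = {Y_{f(t)} : t ∈ [a,b]} have the same finite-dimensional distributions. (In other words, the finite-dimensional distributions of an additive 𝒜-indexed process determine and are determined by the finite-dimensional distributions of its projections on simple flows.) -/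
open Set MeasureTheory ProbabilityTheory Filter
open scoped NNReal ENNReal symmDiff

noncomputable section

/-- The class of finite unions of sets from a class `𝒜` (the empty union gives `∅`),
denoted `𝒜(u)` in the paper. -/
def finUnions {T : Type*} (𝒜 : Set (Set T)) : Set (Set T) :=
  {B | ∃ (n : ℕ) (f : Fin n → Set T), (∀ i, f i ∈ 𝒜) ∧ B = ⋃ i, f i}

/-- An indexing collection on a metric space `T`
(Ivanoff–Merzbach; Herbin–Merzbach, Definition 2.1). -/
structure IndexingCollection (T : Type*) [MetricSpace T] where
  carrier : Set (Set T)
  carrier_nonempty : carrier.Nonempty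
  isCompact_mem : ∀ A ∈ carrier, IsCompact A
  isPreconnected_mem : ∀ A ∈ carrier, IsPreconnected A
  empty_mem : ∅ ∈ carrier
  interior_ne : ∀ A ∈ carrier, A ≠ ∅ → A ≠ univ → interior A ≠ A
  B : ℕ → Set T
  B_mem : ∀ n, B n ∈ finUnions carrier
  B_mono : Monotone B
  iUnion_interior_B : (⋃ n, interior (B n)) = univ
  sInter_mem : ∀ 𝒜' ⊆ carrier, 𝒜'.Nonempty → ⋂₀ 𝒜' ∈ carrier
  inter_nonempty : ∀ A ∈ carrier, ∀ A' ∈ carrier, A.Nonempty → A'.Nonempty →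
    (A ∩ A').Nonempty
  chain_closure_mem : ∀ A : ℕ → Set T, (∀ i, A i ∈ carrier) → Monotone A →
    (∃ n, ∀ i, A i ⊆ B n) → closure (⋃ i, A i) ∈ carrier
  generateFrom_eq : MeasurableSpace.generateFrom carrier = borel T
  An : ℕ → Set (Set T)
  An_finite : ∀ n, (An n).Finite
  An_subset : ∀ n, An n ⊆ carrier
  An_mono : Monotone An
  An_inter_mem : ∀ n, ∀ A ∈ An n, ∀ A' ∈ An n, A ∩ A' ∈ An n
  empty_mem_Anu : ∀ n, (∅ : Set T) ∈ finUnions (An n)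
  B_mem_Anu : ∀ n, B n ∈ finUnions (An n)
  g : ℕ → Set T → Set T
  g_mem : ∀ n, ∀ A ∈ carrier, g n A ∈ finUnions (An n) ∪ {univ}
  g_sInter : ∀ n, ∀ 𝒜' ⊆ carrier, 𝒜'.Nonempty → g n (⋂₀ 𝒜') = ⋂ A ∈ 𝒜', g n A
  g_iUnion : ∀ n (k l : ℕ) (a : Fin k → Set T) (a' : Fin l → Set T),
    (∀ i, a i ∈ carrier) → (∀ j, a' j ∈ carrier) → (⋃ i, a i) = (⋃ j, a' j) →
    (⋃ i, g n (a i)) = ⋃ j, g n (a' j)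
  subset_interior_g : ∀ n, ∀ A ∈ carrier, A ⊆ interior (g n A)
  g_antitone : ∀ n l : ℕ, l ≤ n → ∀ A ∈ carrier, g n A ⊆ g l A
  iInter_g_eq : ∀ A ∈ carrier, A = ⋂ n, g n A
  g_inter_mem : ∀ n, ∀ A ∈ carrier, ∀ A' ∈ carrier, g n A ∩ A' ∈ carrier
  g_inter_mem_An : ∀ n, ∀ A ∈ carrier, ∀ A' ∈ An n, g n A ∩ A' ∈ An n
  g_empty : ∀ n, g n (∅ : Set T) = ∅
  iInter_eq_closure_iUnion : ∀ C : ℕ → Set T, (∀ i, C i ∈ finUnions carrier) →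
    ∃ D : ℕ → Set T, (∀ i, D i ∈ carrier) ∧ (⋂ i, C i) = closure (⋃ i, D i)

/-- An elementary flow on `[a, b]`: an increasing, outer- and inner-continuous map
into the indexing collection. -/
def IsElementaryFlow {T : Type*} [TopologicalSpace T] (𝒜 : Set (Set T)) (a b : ℝ)
    (f : ℝ → Set T) : Prop :=
  (∀ t ∈ Icc a b, f t ∈ 𝒜) ∧
  (∀ s ∈ Icc a b, ∀ t ∈ Icc a b, s < t → f s ⊆ f t) ∧
  (∀ s ∈ Ico a b, f s = ⋂ v ∈ Ioc s b, f v) ∧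
  (∀ s ∈ Ioc a b, f s = closure (⋃ u ∈ Ico a s, f u))

/-- An elementary flow defined on all of `ℝ₊`. -/
def IsElementaryFlowNN {T : Type*} [TopologicalSpace T] (𝒜 : Set (Set T))
    (f : ℝ → Set T) : Prop :=
  (∀ t, 0 ≤ t → f t ∈ 𝒜) ∧
  (∀ s t, 0 ≤ s → s < t → f s ⊆ f t) ∧
  (∀ s, 0 ≤ s → f s = ⋂ v ∈ Ioi s, f v) ∧
  (∀ s, 0 < s → f s = closure (⋃ u ∈ Ico 0 s, f u))

/-- `Y` is a centered (one-dimensional) Gaussian random variable. -/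
def IsCenteredGaussianRV {Ω : Type*} [MeasurableSpace Ω] (P : Measure Ω)
    (Y : Ω → ℝ) : Prop :=
  ∃ v : ℝ≥0, Measure.map Y P = gaussianReal 0 v

/-- Every finite real linear combination of values of the set-indexed process `X`
over `𝒜` is a centered Gaussian random variable. -/
def IsSetIndexedGaussian {T Ω : Type*} [MeasurableSpace Ω] (𝒜 : Set (Set T))
    (P : Measure Ω) (X : Set T → Ω → ℝ) : Prop :=
  ∀ (n : ℕ) (U : Fin n → Set T) (c : Fin n → ℝ), (∀ i, U i ∈ 𝒜) →
    IsCenteredGaussianRV P fun ω => ∑ i, c i * X (U i) ω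

/-- `X` is a set-indexed fractional Brownian motion of index `H` on `(T, 𝒜, m)`. -/
def IsSifBm {T Ω : Type*} [MeasurableSpace T] [MeasurableSpace Ω] (𝒜 : Set (Set T))
    (m : Measure T) (H : ℝ) (P : Measure Ω) (X : Set T → Ω → ℝ) : Prop :=
  IsSetIndexedGaussian 𝒜 P X ∧
  ∀ U ∈ 𝒜, ∀ V ∈ 𝒜,
    ∫ ω, X U ω * X V ω ∂P =
      (1 / 2) * ((m U).toReal ^ (2 * H) + (m V).toReal ^ (2 * H)
        - (m (U ∆ V)).toReal ^ (2 * H))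

/-- A one-parameter fractional Brownian motion of Hurst index `H` on the
interval `[a, b]`: a centered Gaussian process with the fBm covariance. -/
def IsFBmOn {Ω : Type*} [MeasurableSpace Ω] (P : Measure Ω) (H a b : ℝ)
    (Y : ℝ → Ω → ℝ) : Prop :=
  (∀ (n : ℕ) (t : Fin n → ℝ) (c : Fin n → ℝ), (∀ i, t i ∈ Icc a b) →
    IsCenteredGaussianRV P fun ω => ∑ i, c i * Y (t i) ω) ∧
  ∀ s ∈ Icc a b, ∀ t ∈ Icc a b,
    ∫ ω, Y s ω * Y t ω ∂P = (1 / 2) * (s ^ (2 * H) + t ^ (2 * H) - |t - s| ^ (2 * H))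

/-- `X` is an additive set-indexed process: `X_∅ = 0` a.s. and
`X_{U ∪ V} = X_U + X_V - X_{U ∩ V}` a.s. on `𝒜(u)`. -/
def IsAdditiveProcess {T Ω : Type*} [MeasurableSpace Ω] (𝒜 : Set (Set T))
    (P : Measure Ω) (X : Set T → Ω → ℝ) : Prop :=
  (∀ᵐ ω ∂P, X ∅ ω = 0) ∧
  ∀ U ∈ finUnions 𝒜, ∀ V ∈ finUnions 𝒜,
    ∀ᵐ ω ∂P, X (U ∪ V) ω = X U ω + X V ω - X (U ∩ V) ω

/-- `X` is `L²`-monotone outer-continuous. -/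
def L2MonotoneOuterContinuous {T Ω : Type*} [MeasurableSpace Ω] (𝒜 : Set (Set T))
    (P : Measure Ω) (X : Set T → Ω → ℝ) : Prop :=
  ∀ U : ℕ → Set T, (∀ n, U n ∈ 𝒜) → Antitone U →
    Tendsto (fun n => ∫ ω, (X (U n) ω - X (⋂ k, U k) ω) ^ 2 ∂P) atTop (nhds 0)

/-- `X` has `m`-stationary `𝒞₀`-increments (Herbin–Merzbach, Definition 5.2). -/
def HasMStationaryC0Increments {T Ω : Type*} [MeasurableSpace T] [MeasurableSpace Ω]
    (𝒜 : Set (Set T)) (m : Measure T) (P : Measure Ω) (X : Set T → Ω → ℝ) : Prop :=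
  ∀ (n : ℕ) (V : Set T), V ∈ 𝒜 → ∀ U A : Fin n → Set T,
    (∀ i, U i ∈ 𝒜) → (∀ i, A i ∈ 𝒜) →
    (∀ i j : Fin n, i ≤ j → U i ⊆ U j) → (∀ i j : Fin n, i ≤ j → A i ⊆ A j) →
    (∀ i, V ⊆ U i) →
    (∀ i, m (U i \ V) = m (A i)) →
    Measure.map (fun ω (i : Fin n) => X (U i) ω - X V ω) P
      = Measure.map (fun ω (i : Fin n) => X (A i) ω) P

/-- The range of the time change `θ : t ↦ m(f(t))` along a flow defined on `ℝ₊`. -/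
def flowRange {T : Type*} [MeasurableSpace T] (m : Measure T) (f : ℝ → Set T) : Set ℝ :=
  (fun s => (m (f s)).toReal) '' Ici (0 : ℝ)

/-- A simple flow on `[a, b]`: a concatenation of finitely many elementary flows,
`f(s) = f_i(s) ∪ ⋃_{j < i} f_j(t_j)` on `[t_{i-1}, t_i]`. -/
def IsSimpleFlow {T : Type*} [TopologicalSpace T] (𝒜 : Set (Set T)) (a b : ℝ)
    (f : ℝ → Set T) : Prop :=
  ∃ (n : ℕ) (t : ℕ → ℝ) (g : ℕ → ℝ → Set T), 0 < n ∧
    t 0 = a ∧ t n = b ∧ (∀ i < n, t i < t (i + 1)) ∧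
    (∀ i, 1 ≤ i → i ≤ n → IsElementaryFlow 𝒜 (t (i - 1)) (t i) (g i)) ∧
    ∀ i, 1 ≤ i → i ≤ n → ∀ s ∈ Icc (t (i - 1)) (t i),
      f s = g i s ∪ ⋃ j ∈ Finset.Ico 1 i, g j (t j)

theorem exists_strictMono_size {T : Type*} [MetricSpace T] {K : Set T} (hK : IsCompact K)
    (hne : K.Nonempty) :
    ∃ φ : Set T → ℝ,
      (∀ D D', D.Nonempty → IsClosed D → D ⊂ D' → D' ⊆ K → φ D < φ D') ∧
      ∀ ε > 0, ∀ D E : Set T, D.Nonempty → E.Nonempty → E ⊆ Metric.thickening ε D →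
        φ E ≤ φ D + 2 * ε := by
  obtain ⟨c, hc, hKc⟩ := hK.isSeparable
  have hcne : c.Nonempty := closure_nonempty_iff.1 (hne.mono hKc)
  obtain ⟨x, rfl⟩ := hc.exists_eq_range hcne
  have hgeom : HasSum (fun k : ℕ => (1 / 2 : ℝ) ^ k) 2 := hasSum_geometric_two
  have hsum : ∀ D : Set T,
      Summable fun k : ℕ => (1 / 2 : ℝ) ^ k * min 1 (Metric.infDist (x k) D) := fun D =>
    Summable.of_nonneg_of_le
      (fun k => mul_nonneg (by positivity) (le_min zero_le_one Metric.infDist_nonneg))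
      (fun k => mul_le_of_le_one_right (by positivity) (min_le_left _ _)) hgeom.summable
  refine ⟨fun D => -∑' k, (1 / 2 : ℝ) ^ k * min 1 (Metric.infDist (x k) D), ?_, ?_⟩
  · intro D D' hD hDc hDD' hD'K
    obtain ⟨y, hyD', hyD⟩ := exists_of_ssubset hDD'
    have hpos : 0 < Metric.infDist y D := (hDc.notMem_iff_infDist_pos hD).1 hyD
    obtain ⟨z, ⟨k, rfl⟩, hk⟩ := Metric.mem_closure_iff.1 (hKc (hD'K hyD'))
      (min (Metric.infDist y D / 2) 1) (by positivity)
    have h1 : Metric.infDist (x k) D' ≤ dist y (x k) := by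
      rw [dist_comm]; exact Metric.infDist_le_dist_of_mem hyD'
    have h2 : Metric.infDist y D ≤ Metric.infDist (x k) D + dist y (x k) :=
      Metric.infDist_le_infDist_add_dist
    have h3 := lt_min_iff.1 hk
    refine neg_lt_neg (Summable.tsum_lt_tsum (i := k) (fun j => ?_) ?_ (hsum _) (hsum _))
    · exact mul_le_mul_of_nonneg_left
        (min_le_min le_rfl (Metric.infDist_le_infDist_of_subset hDD'.1 hD)) (by positivity)
    · refine mul_lt_mul_of_pos_left (lt_min ?_ ?_) (by positivity)
      · exact (min_le_right _ _).trans_lt (by linarith)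
      · exact (min_le_right _ _).trans_lt (by linarith)
  · intro ε hε D E hD hE hED
    have key : ∀ y, Metric.infDist y D ≤ Metric.infDist y E + ε := by
      intro y
      refine le_of_forall_pos_le_add fun δ hδ => ?_
      obtain ⟨e, he, hye⟩ := (Metric.infDist_lt_iff hE).1
        (lt_add_of_pos_right (Metric.infDist y E) hδ)
      obtain ⟨d, hd, hed⟩ := Metric.mem_thickening_iff.1 (hED he)
      have := Metric.infDist_le_dist_of_mem (x := y) hd
      have := dist_triangle y e d
      linarith
    have hle : ∑' k, (1 / 2 : ℝ) ^ k * min 1 (Metric.infDist (x k) D) ≤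
        ∑' k, ((1 / 2 : ℝ) ^ k * min 1 (Metric.infDist (x k) E) + (1 / 2 : ℝ) ^ k * ε) := by
      refine Summable.tsum_le_tsum (fun k => ?_) (hsum _)
        ((hsum _).add (hgeom.summable.mul_right ε))
      rw [← mul_add]
      refine mul_le_mul_of_nonneg_left ?_ (by positivity)
      rcases le_total 1 (Metric.infDist (x k) E) with h | h
      · rw [min_eq_left h]
        linarith [min_le_left 1 (Metric.infDist (x k) D)]
      · rw [min_eq_right h]
        exact (min_le_right _ _).trans (key _)
    rw [(hsum E).tsum_add (hgeom.summable.mul_right ε), tsum_mul_right, hgeom.tsum_eq] at hle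
    linarith

theorem exists_normalized_size {T : Type*} [MetricSpace T] {A K : Set T} (hK : IsCompact K)
    (hA : IsClosed A) (hne : A.Nonempty) (hAK : A ⊂ K) {a b : ℝ} (hab : a < b) :
    ∃ ψ : Set T → ℝ, ψ A = a ∧ ψ K = b ∧
      (∀ D D', D.Nonempty → IsClosed D → D ⊂ D' → D' ⊆ K → ψ D < ψ D') ∧
      ∀ ε > 0, ∃ δ > 0, ∀ D E : Set T, D.Nonempty → E.Nonempty →
        E ⊆ Metric.thickening δ D → ψ E ≤ ψ D + ε := by
  obtain ⟨φ, hmono, hcont⟩ := exists_strictMono_size hK (hne.mono hAK.1)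
  have hlt := hmono A K hne hA hAK le_rfl
  have hr : 0 < (b - a) / (φ K - φ A) := div_pos (by linarith) (by linarith)
  refine ⟨fun D => a + (b - a) / (φ K - φ A) * (φ D - φ A), by simp, ?_, ?_, ?_⟩
  · have : φ K - φ A ≠ 0 := by linarith
    field_simp
    ring
  · intro D D' h1 h2 h3 h4
    have := mul_lt_mul_of_pos_left (hmono D D' h1 h2 h3 h4) hr
    simp only [mul_sub]
    linarith
  · intro ε hε
    refine ⟨ε / (2 * ((b - a) / (φ K - φ A))), by positivity, fun D E hD hE hDE => ?_⟩
    have := mul_le_mul_of_nonneg_left (hcont _ (by positivity) D E hD hE hDE) hr.le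
    have h2 : (b - a) / (φ K - φ A) * (2 * (ε / (2 * ((b - a) / (φ K - φ A))))) = ε := by
      generalize (b - a) / (φ K - φ A) = r at hr
      field_simp
    simp only [mul_sub]
    rw [mul_add, h2] at this
    linarith

theorem IsChain.exists_subset_thickening_closure_sUnion {T : Type*} [MetricSpace T]
    {S : Set (Set T)} (hS : IsChain (· ⊆ ·) S) (hSne : S.Nonempty)
    (hK : IsCompact (closure (⋃₀ S))) {δ : ℝ} (hδ : 0 < δ) :
    ∃ D ∈ S, closure (⋃₀ S) ⊆ Metric.thickening δ D := by
  have := hSne.to_subtype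
  have hcover : closure (⋃₀ S) ⊆ ⋃ D : S, Metric.thickening δ (D : Set T) := by
    intro x hx
    obtain ⟨y, ⟨D, hD, hy⟩, hxy⟩ := Metric.mem_closure_iff.1 hx δ hδ
    exact mem_iUnion.2 ⟨⟨D, hD⟩, Metric.mem_thickening_iff.2 ⟨y, hy, hxy⟩⟩
  have hdir : Directed (· ⊆ ·) fun D : S => Metric.thickening δ (D : Set T) := by
    intro D E
    rcases hS.total D.2 E.2 with h | h
    · exact ⟨E, Metric.thickening_subset_of_subset _ h, subset_rfl⟩
    · exact ⟨D, subset_rfl, Metric.thickening_subset_of_subset _ h⟩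
  obtain ⟨⟨D, hD⟩, h⟩ := hK.elim_directed_cover _ (fun D => Metric.isOpen_thickening) hcover hdir
  exact ⟨D, hD, h⟩

theorem IsChain.exists_subset_thickening_sInter {T : Type*} [MetricSpace T]
    {S : Set (Set T)} (hS : IsChain (· ⊆ ·) S) (hSne : S.Nonempty)
    (hK : ∀ D ∈ S, IsCompact D) {δ : ℝ} (hδ : 0 < δ) :
    ∃ D ∈ S, D ⊆ Metric.thickening δ (⋂₀ S) := by
  have := hSne.to_subtype
  have hdir : Directed (· ⊇ ·) fun D : S => (D : Set T) := by
    intro D E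
    rcases hS.total D.2 E.2 with h | h
    · exact ⟨D, subset_rfl, h⟩
    · exact ⟨E, h, subset_rfl⟩
  have hnhds : ∀ x ∈ ⋂ D : S, (D : Set T), Metric.thickening δ (⋂₀ S) ∈ nhds x := by
    intro x hx
    rw [← sInter_eq_iInter] at hx
    exact Metric.isOpen_thickening.mem_nhds (Metric.self_subset_thickening hδ _ hx)
  obtain ⟨⟨D, hD⟩, h⟩ := exists_subset_nhds_of_isCompact' hdir (fun D => hK D D.2)
    (fun D => (hK D D.2).isClosed) hnhds
  exact ⟨D, hD, h⟩

theorem isElementaryFlow_const {T : Type*} [TopologicalSpace T] {𝒜 : Set (Set T)} {A : Set T}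
    (hA : A ∈ 𝒜) (hcl : IsClosed A) (a b : ℝ) : IsElementaryFlow 𝒜 a b fun _ => A := by
  refine ⟨fun _ _ => hA, fun _ _ _ _ _ => subset_rfl, fun s hs => ?_, fun s hs => ?_⟩
  · rw [biInter_const (nonempty_Ioc.2 hs.2)]
  · rw [biUnion_const (nonempty_Ico.2 hs.1), hcl.closure_eq]

namespace IndexingCollection

variable {T : Type*} [MetricSpace T] (I : IndexingCollection T)

theorem exists_subset_B {K : Set T} (hK : IsCompact K) : ∃ n, K ⊆ I.B n := by
  obtain ⟨n, hn⟩ := hK.elim_directed_cover (fun n => interior (I.B n))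
    (fun n => isOpen_interior) (by simp [I.iUnion_interior_B])
    (monotone_nat_of_le_succ fun n => interior_mono (I.B_mono n.le_succ)).directed_le
  exact ⟨n, hn.trans interior_subset⟩

theorem inter_mem {A A' : Set T} (hA : A ∈ I.carrier) (hA' : A' ∈ I.carrier) :
    A ∩ A' ∈ I.carrier := by
  rw [← sInter_pair]
  exact I.sInter_mem _ (by simp [insert_subset_iff, hA, hA']) (by simp)

theorem closure_sUnion_mem {K : Set T} (hK : IsCompact K) {S : Set (Set T)}
    (hS : S ⊆ I.carrier) (hchain : IsChain (· ⊆ ·) S) (hSne : S.Nonempty)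
    (hne : ∀ D ∈ S, D.Nonempty) (hSK : ∀ D ∈ S, D ⊆ K) : closure (⋃₀ S) ∈ I.carrier := by
  have hcl : ∀ D ∈ S, IsClosed D := fun D hD => (I.isCompact_mem D (hS hD)).isClosed
  have hKne : K.Nonempty := let ⟨D, hD⟩ := hSne; (hne D hD).mono (hSK D hD)
  obtain ⟨φ, hmono, -⟩ := exists_strictMono_size hK hKne
  have hle : ∀ D ∈ S, ∀ D' ∈ S, φ D ≤ φ D' → D ⊆ D' := by
    intro D hD D' hD' h
    rcases hchain.total hD hD' with h' | h'
    · exact h'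
    · by_contra hn
      exact absurd (hmono D' D (hne D' hD') (hcl D' hD') ⟨h', hn⟩ (hSK D hD)) h.not_gt
  have hbdd : BddAbove (φ '' S) := by
    refine ⟨φ K, ?_⟩
    rintro _ ⟨D, hD, rfl⟩
    rcases (hSK D hD).eq_or_ssubset with h | h
    · rw [h]
    · exact (hmono D K (hne D hD) (hcl D hD) h le_rfl).le
  obtain ⟨u, humono, hu, huS⟩ := exists_seq_tendsto_sSup (hSne.image φ) hbdd
  by_cases hmax : ∃ D ∈ S, sSup (φ '' S) ≤ φ D
  · obtain ⟨D, hD, hDmax⟩ := hmax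
    have : ⋃₀ S = D := (sUnion_subset fun D' hD' => hle D' hD' D hD
      ((le_csSup hbdd (mem_image_of_mem φ hD')).trans hDmax)).antisymm (subset_sUnion_of_mem hD)
    rw [this, (hcl D hD).closure_eq]
    exact hS hD
  · push Not at hmax
    choose D hDS hDu using huS
    have : ⋃₀ S = ⋃ n, D n := by
      refine (sUnion_subset fun E hE => ?_).antisymm
        (iUnion_subset fun n => subset_sUnion_of_mem (hDS n))
      obtain ⟨n, hn⟩ := (hu.eventually (lt_mem_nhds (hmax E hE))).exists
      exact subset_iUnion_of_subset n (hle E hE _ (hDS n) (by rw [hDu]; exact hn.le))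
    rw [this]
    obtain ⟨n, hn⟩ := I.exists_subset_B hK
    refine I.chain_closure_mem D (fun n => hS (hDS n)) (fun i j hij => ?_)
      ⟨n, fun i => (hSK _ (hDS i)).trans hn⟩
    exact hle _ (hDS i) _ (hDS j) (by rw [hDu, hDu]; exact humono hij)

theorem exists_ssubset_ssubset {D D' : Set T} (hD : D ∈ I.carrier) (hD' : D' ∈ I.carrier)
    (hne : D.Nonempty) (hlt : D ⊂ D') : ∃ E ∈ I.carrier, D ⊂ E ∧ E ⊂ D' := by
  by_contra! hgap
  have hsub : ∀ n, D ⊆ I.g n D ∩ D' := fun n =>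
    subset_inter ((I.subset_interior_g n D hD).trans interior_subset) hlt.1
  have hsome : ∃ n, I.g n D ∩ D' ⊆ D := by
    by_contra! h
    have hall : ∀ n, D' ⊆ I.g n D := by
      intro n
      by_contra hn
      exact hgap _ (I.g_inter_mem n D hD D' hD') ⟨hsub n, h n⟩
        ⟨inter_subset_right, fun h' => hn (h'.trans inter_subset_left)⟩
    refine hlt.2 ?_
    rw [I.iInter_g_eq D hD]
    exact subset_iInter hall
  obtain ⟨n, hn⟩ := hsome
  have hDc : IsClosed D := (I.isCompact_mem D hD).isClosed
  obtain ⟨y, hyD', hyD⟩ := exists_of_ssubset hlt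
  obtain ⟨x, hx⟩ := hne
  obtain ⟨z, hzD', hz, hzD⟩ := I.isPreconnected_mem D' hD' (interior (I.g n D)) Dᶜ
    isOpen_interior hDc.isOpen_compl
    (fun w _ => (em (w ∈ D)).imp (fun h => I.subset_interior_g n D hD h) id)
    ⟨x, hlt.1 hx, I.subset_interior_g n D hD hx⟩ ⟨y, hyD', hyD⟩
  exact hzD (hn ⟨interior_subset hz, hzD'⟩)

theorem exists_maximal_chain (A K : Set T) :
    ∃ C ⊆ I.carrier, (∀ D ∈ C, A ⊆ D ∧ D ⊆ K) ∧ IsChain (· ⊆ ·) C ∧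
      (∀ E ∈ I.carrier, A ⊆ E → E ⊆ K → (∀ D ∈ C, E ⊆ D ∨ D ⊆ E) → E ∈ C) := by
  let F : Flag {D : Set T // D ∈ I.carrier ∧ A ⊆ D ∧ D ⊆ K} := Flag.ofIsMaxChain _ maxChain_spec
  refine ⟨Subtype.val '' (F : Set {D : Set T // D ∈ I.carrier ∧ A ⊆ D ∧ D ⊆ K}), ?_, ?_, ?_, ?_⟩
  · rintro _ ⟨D, -, rfl⟩
    exact D.2.1
  · rintro _ ⟨D, -, rfl⟩
    exact D.2.2
  · rintro _ ⟨D, hD, rfl⟩ _ ⟨E, hE, rfl⟩ -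
    exact F.le_or_le hD hE
  · intro E hE hAE hEK h
    refine ⟨⟨E, hE, hAE, hEK⟩, Flag.mem_iff_forall_le_or_ge.2 fun D hD => ?_, rfl⟩
    exact h D.1 ⟨D, hD, rfl⟩

theorem exists_elementaryFlow {A K : Set T} (hA : A ∈ I.carrier) (hK : K ∈ I.carrier)
    (hne : A.Nonempty) (hAK : A ⊆ K) {a b : ℝ} (hab : a < b) :
    ∃ f, IsElementaryFlow I.carrier a b f ∧ f a = A ∧ f b = K := by
  rcases hAK.eq_or_ssubset with rfl | hlt
  · exact ⟨fun _ => A, isElementaryFlow_const hA (I.isCompact_mem A hA).isClosed a b, rfl, rfl⟩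
  have hKc := I.isCompact_mem K hK
  obtain ⟨ψ, hψA, hψK, hmono, hcont⟩ :=
    exists_normalized_size hKc (I.isCompact_mem A hA).isClosed hne hlt hab
  obtain ⟨C, hC, hCAK, hchain, hmax⟩ := I.exists_maximal_chain A K
  have hCne : ∀ D ∈ C, D.Nonempty := fun D hD => hne.mono (hCAK D hD).1
  have hCcl : ∀ D ∈ C, IsClosed D := fun D hD => (I.isCompact_mem D (hC hD)).isClosed
  have hAC : A ∈ C := hmax A hA le_rfl hAK fun D hD => .inl (hCAK D hD).1
  have hKC : K ∈ C := hmax K hK hAK le_rfl fun D hD => .inr (hCAK D hD).2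
  have hle : ∀ D ∈ C, ∀ D' ∈ C, ψ D ≤ ψ D' → D ⊆ D' := by
    intro D hD D' hD' h
    rcases hchain.total hD hD' with h' | h'
    · exact h'
    · by_contra hn
      exact absurd (hmono D' D (hCne D' hD') (hCcl D' hD') ⟨h', hn⟩ (hCAK D hD).2) h.not_gt
  have hψle : ∀ D ∈ C, ∀ D' ∈ C, D ⊆ D' → ψ D ≤ ψ D' := by
    intro D hD D' hD' h
    rcases h.eq_or_ssubset with h | h
    · rw [h]
    · exact (hmono D D' (hCne D hD) (hCcl D hD) h (hCAK D' hD').2).le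
  have hsup : ∀ S ⊆ C, S.Nonempty → closure (⋃₀ S) ∈ C := by
    intro S hS hSne
    have hsub : ∀ D ∈ C, (∀ E ∈ S, E ⊆ D) → closure (⋃₀ S) ⊆ D := fun D hD h =>
      closure_minimal (sUnion_subset h) (hCcl D hD)
    refine hmax _ (I.closure_sUnion_mem hKc (hS.trans hC) (hchain.mono hS) hSne
      (fun D hD => hCne D (hS hD)) fun D hD => (hCAK D (hS hD)).2) ?_
      (hsub K hKC fun D hD => (hCAK D (hS hD)).2) fun D hD => ?_
    · obtain ⟨D, hD⟩ := hSne
      exact (hCAK D (hS hD)).1.trans ((subset_sUnion_of_mem hD).trans subset_closure)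
    · by_cases h : ∀ E ∈ S, E ⊆ D
      · exact .inl (hsub D hD h)
      · push Not at h
        obtain ⟨E, hE, hED⟩ := h
        exact .inr (((hchain.total hD (hS hE)).resolve_right hED).trans
          ((subset_sUnion_of_mem hE).trans subset_closure))
  have hinf : ∀ S ⊆ C, S.Nonempty → ⋂₀ S ∈ C := by
    intro S hS hSne
    refine hmax _ (I.sInter_mem S (hS.trans hC) hSne)
      (subset_sInter fun D hD => (hCAK D (hS hD)).1) ?_ fun D hD => ?_
    · obtain ⟨D, hD⟩ := hSne
      exact (sInter_subset_of_mem hD).trans (hCAK D (hS hD)).2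
    · by_cases h : ∀ E ∈ S, D ⊆ E
      · exact .inr (subset_sInter h)
      · push Not at h
        obtain ⟨E, hE, hED⟩ := h
        exact .inl ((sInter_subset_of_mem hE).trans
          ((hchain.total hD (hS hE)).resolve_left hED))
  have hsurj : ∀ t, t ∈ Icc a b → ∃ D ∈ C, ψ D = t := by
    intro t ht
    let S₁ := {D ∈ C | ψ D ≤ t}
    let S₂ := {D ∈ C | t ≤ ψ D}
    have hS₁C : S₁ ⊆ C := sep_subset _ _
    have hS₂C : S₂ ⊆ C := sep_subset _ _
    have hS₁ne : S₁.Nonempty := ⟨A, hAC, hψA.le.trans ht.1⟩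
    have hS₂ne : S₂.Nonempty := ⟨K, hKC, ht.2.trans hψK.ge⟩
    have h₁ : closure (⋃₀ S₁) ∈ C := hsup S₁ hS₁C hS₁ne
    have h₂ : ⋂₀ S₂ ∈ C := hinf S₂ hS₂C hS₂ne
    have h₁₂ : closure (⋃₀ S₁) ⊆ ⋂₀ S₂ := closure_minimal
      (sUnion_subset fun D hD => subset_sInter fun E hE => hle D hD.1 E hE.1 (hD.2.trans hE.2))
      (hCcl _ h₂)
    have hψ₁ : ψ (closure (⋃₀ S₁)) ≤ t := by
      refine le_of_forall_pos_le_add fun ε hε => ?_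
      obtain ⟨δ, hδ, h⟩ := hcont ε hε
      obtain ⟨D, hD, hDS⟩ := (hchain.mono hS₁C).exists_subset_thickening_closure_sUnion hS₁ne
        (I.isCompact_mem _ (hC h₁)) hδ
      exact (h D _ (hCne D hD.1) (hCne _ h₁) hDS).trans (add_le_add_left hD.2 ε)
    have hψ₂ : t ≤ ψ (⋂₀ S₂) := by
      refine le_of_forall_pos_le_add fun ε hε => ?_
      obtain ⟨δ, hδ, h⟩ := hcont ε hε
      obtain ⟨D, hD, hDS⟩ := (hchain.mono hS₂C).exists_subset_thickening_sInter hS₂ne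
        (fun D hD => I.isCompact_mem D (hC hD.1)) hδ
      exact hD.2.trans (h _ D (hCne _ h₂) (hCne D hD.1) hDS)
    have heq : closure (⋃₀ S₁) = ⋂₀ S₂ := by
      by_contra hn
      obtain ⟨E, hE, hE₁, hE₂⟩ := I.exists_ssubset_ssubset (hC h₁) (hC h₂) (hCne _ h₁)
        (h₁₂.ssubset_of_ne hn)
      have hEC : E ∈ C := by
        refine hmax E hE ((hCAK _ h₁).1.trans hE₁.1) (hE₂.1.trans (hCAK _ h₂).2) fun D hD => ?_
        rcases le_total (ψ D) t with h | h
        · exact .inr (((subset_sUnion_of_mem (show D ∈ S₁ from ⟨hD, h⟩)).trans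
            subset_closure).trans hE₁.1)
        · exact .inl (hE₂.1.trans (sInter_subset_of_mem (show D ∈ S₂ from ⟨hD, h⟩)))
      rcases le_total (ψ E) t with h | h
      · exact hE₁.2 ((subset_sUnion_of_mem (show E ∈ S₁ from ⟨hEC, h⟩)).trans subset_closure)
      · exact hE₂.2 (sInter_subset_of_mem (show E ∈ S₂ from ⟨hEC, h⟩))
    exact ⟨_, h₁, hψ₁.antisymm (heq ▸ hψ₂)⟩
  choose! f hfC hfψ using hsurj
  have hfmono : ∀ s ∈ Icc a b, ∀ t ∈ Icc a b, s ≤ t → f s ⊆ f t := fun s hs t ht hst =>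
    hle _ (hfC s hs) _ (hfC t ht) (by rwa [hfψ s hs, hfψ t ht])
  have heq_of : ∀ t ∈ Icc a b, ∀ D ∈ C, ψ D = t → f t = D := fun t ht D hD h =>
    (hle _ (hfC t ht) D hD (by rw [hfψ t ht, h])).antisymm
      (hle D hD _ (hfC t ht) (by rw [hfψ t ht, h]))
  refine ⟨f, ⟨fun t ht => hC (hfC t ht), fun s hs t ht hst => hfmono s hs t ht hst.le,
    fun s hs => ?_, fun s hs => ?_⟩, heq_of a (left_mem_Icc.2 hab.le) A hAC hψA,
    heq_of b (right_mem_Icc.2 hab.le) K hKC hψK⟩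
  · have hs' : s ∈ Icc a b := Ico_subset_Icc_self hs
    have hIoc : ∀ v ∈ Ioc s b, v ∈ Icc a b := fun v hv => ⟨hs.1.trans hv.1.le, hv.2⟩
    have hE : (⋂ v ∈ Ioc s b, f v) ∈ C := by
      rw [← sInter_image]
      exact hinf _ (image_subset_iff.2 fun v hv => hfC v (hIoc v hv))
        ((nonempty_Ioc.2 hs.2).image f)
    refine (subset_iInter₂ fun v hv => hfmono s hs' v (hIoc v hv) hv.1.le).antisymm
      (hle _ hE _ (hfC s hs') ?_)
    rw [hfψ s hs']
    refine le_of_forall_gt_imp_ge_of_dense fun v hv => ?_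
    have hmin : min v b ∈ Ioc s b := ⟨lt_min hv hs.2, min_le_right _ _⟩
    calc ψ (⋂ v ∈ Ioc s b, f v) ≤ ψ (f (min v b)) :=
          hψle _ hE _ (hfC _ (hIoc _ hmin)) (biInter_subset_of_mem hmin)
      _ ≤ v := by rw [hfψ _ (hIoc _ hmin)]; exact min_le_left _ _
  · have hs' : s ∈ Icc a b := Ioc_subset_Icc_self hs
    have hIco : ∀ u ∈ Ico a s, u ∈ Icc a b := fun u hu => ⟨hu.1, hu.2.le.trans hs.2⟩
    have hE : closure (⋃ u ∈ Ico a s, f u) ∈ C := by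
      rw [← sUnion_image]
      exact hsup _ (image_subset_iff.2 fun u hu => hfC u (hIco u hu))
        ((nonempty_Ico.2 hs.1).image f)
    refine (hle _ (hfC s hs') _ hE ?_).antisymm (closure_minimal
      (iUnion₂_subset fun u hu => hfmono u (hIco u hu) s hs' hu.2.le) (hCcl _ (hfC s hs')))
    rw [hfψ s hs']
    refine le_of_forall_lt_imp_le_of_dense fun u hu => ?_
    have hmax' : max u a ∈ Ico a s := ⟨le_max_right _ _, max_lt hu hs.1⟩
    calc u ≤ ψ (f (max u a)) := by rw [hfψ _ (hIco _ hmax')]; exact le_max_left _ _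
      _ ≤ ψ (closure (⋃ u ∈ Ico a s, f u)) := hψle _ (hfC _ (hIco _ hmax')) _ hE
          ((subset_biUnion_of_mem (u := f) hmax').trans subset_closure)

end IndexingCollection

theorem IndexingCollection.exists_simpleFlow {T : Type*} [MetricSpace T]
    (I : IndexingCollection T) {n : ℕ} (A : ℕ → Set T) (hA : ∀ j < n, A j ∈ I.carrier)
    (hne : ∀ j < n, (A j).Nonempty) :
    ∃ (a b : ℝ) (f : ℝ → Set T), a ≤ b ∧ IsSimpleFlow I.carrier a b f ∧
      ∀ i, 1 ≤ i → i ≤ n → ∃ s ∈ Icc a b, f s = ⋃ j : Fin i, A j := by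
  rcases n.eq_zero_or_pos with rfl | hn
  · refine ⟨0, 1, fun _ => ∅, zero_le_one, ⟨1, fun i => i, fun _ _ => ∅, one_pos, by simp, by simp,
      fun i _ => by simp, fun i _ _ => isElementaryFlow_const I.empty_mem isClosed_empty _ _,
      by simp⟩, fun i h1 h2 => absurd h1 (by omega)⟩
  have hflow : ∀ i, 1 ≤ i → i ≤ n → ∃ g : ℝ → Set T,
      IsElementaryFlow I.carrier ((i - 1 : ℕ) : ℝ) i g ∧
        g ((i - 1 : ℕ) : ℝ) = A 0 ∩ A (i - 1) ∧ g i = A (i - 1) := by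
    intro i h1 h2
    have hi : i - 1 < n := by omega
    exact I.exists_elementaryFlow (I.inter_mem (hA 0 hn) (hA _ hi)) (hA _ hi)
      (I.inter_nonempty _ (hA 0 hn) _ (hA _ hi) (hne 0 hn) (hne _ hi)) inter_subset_right
      (by exact_mod_cast (by omega : i - 1 < i))
  choose! g hg hg_left hg_right using hflow
  have hunion : ∀ i ≤ n + 1, (⋃ j ∈ Finset.Ico 1 i, g j j) = ⋃ j : Fin (i - 1), A j := by
    intro i hi
    ext x
    simp only [mem_iUnion, Finset.mem_Ico, exists_prop]
    constructor
    · rintro ⟨j, ⟨h1, h2⟩, hx⟩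
      exact ⟨⟨j - 1, by omega⟩, by rwa [hg_right j h1 (by omega)] at hx⟩
    · rintro ⟨j, hx⟩
      refine ⟨j + 1, by omega, ?_⟩
      rw [hg_right _ (by omega) (by omega)]
      simpa using hx
  let idx : ℝ → ℕ := fun s => max 1 ⌈s⌉₊
  let f : ℝ → Set T := fun s => g (idx s) s ∪ ⋃ j ∈ Finset.Ico 1 (idx s), g j j
  have hf : ∀ i : ℕ, 1 ≤ i → i ≤ n → f i = ⋃ j : Fin i, A j := by
    intro i h1 h2
    have : idx i = i := by simp [idx, h1]
    simp only [f, this]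
    have := hunion (i + 1) (by omega)
    rw [← Finset.insert_Ico_right_eq_Ico_add_one h1, Finset.set_biUnion_insert] at this
    simpa using this
  refine ⟨0, n, f, by positivity, ⟨n, fun i => i, g, hn, by simp, rfl, fun i _ => by simp, hg,
    fun i h1 h2 s hs => ?_⟩, fun i h1 h2 => ⟨i, ⟨by positivity, by exact_mod_cast h2⟩, hf i h1 h2⟩⟩
  rcases hs.1.eq_or_lt with h | h
  · rcases h1.eq_or_lt with rfl | h1'
    · have : idx s = 1 := by simp [idx, ← h]
      simp only [f, this]
    · rw [← h, hf (i - 1) (by omega) (by omega), hg_left i h1 h2, hunion i (by omega)]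
      refine (union_eq_right.2 (inter_subset_left.trans ?_)).symm
      exact subset_iUnion_of_subset ⟨0, by omega⟩ subset_rfl
  · have : idx s = i := by
      have : ⌈s⌉₊ = i := (Nat.ceil_eq_iff (by omega)).2 ⟨h, hs.2⟩
      simp [idx, this, h1]
    simp only [f, this]

/-- A property of sets that propagates through `U ∪ V`, `U ∩ V` for `U, V ∈ 𝒜(u)` the way the
values of an additive set function do. -/
structure IsAdditiveStable {T : Type*} (𝒜 : Set (Set T)) (Q : Set T → Prop) : Prop where
  empty : Q ∅
  union : ∀ U ∈ finUnions 𝒜, ∀ V ∈ finUnions 𝒜, Q U → Q V → Q (U ∩ V) → Q (U ∪ V)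
  of_union : ∀ U ∈ finUnions 𝒜, ∀ V ∈ finUnions 𝒜, Q (U ∪ V) → Q U → Q (U ∩ V) → Q V

theorem mem_finUnions_of_mem {T : Type*} {𝒜 : Set (Set T)} {A : Set T} (hA : A ∈ 𝒜) :
    A ∈ finUnions 𝒜 :=
  ⟨1, fun _ => A, fun _ => hA, (iUnion_const A).symm⟩

theorem Fin.iUnion_castSucc_union_last {T : Type*} {n : ℕ} (a : Fin (n + 1) → Set T) :
    (⋃ i, a i) = (⋃ i : Fin n, a i.castSucc) ∪ a (Fin.last n) := by
  ext x
  simp [Fin.exists_fin_succ']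

theorem IsAdditiveStable.of_mem_finUnions {T : Type*} {𝒜 ℬ : Set (Set T)} {Q : Set T → Prop}
    (hQ : IsAdditiveStable 𝒜 Q) (hℬ𝒜 : ℬ ⊆ 𝒜) (hinter : ∀ A ∈ ℬ, ∀ A' ∈ ℬ, A ∩ A' ∈ ℬ)
    (hℬ : ∀ A ∈ ℬ, Q A) {U : Set T} (hU : U ∈ finUnions ℬ) : Q U := by
  obtain ⟨n, a, ha, rfl⟩ := hU
  induction n with
  | zero => simpa using hQ.empty
  | succ n ih =>
    rw [Fin.iUnion_castSucc_union_last]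
    refine hQ.union _ ⟨n, _, fun i => hℬ𝒜 (ha _), rfl⟩ _ (mem_finUnions_of_mem (hℬ𝒜 (ha _)))
      (ih _ fun i => ha _) (hℬ _ (ha _)) ?_
    rw [iUnion_inter]
    exact ih _ fun i => hinter _ (ha _) _ (ha _)

/-- A finite class closed under intersections can be enumerated so that every additive-stable
property which holds for the unions of initial segments holds for each member. -/
theorem exists_enumeration_forall_isAdditiveStable {T : Type*} (n : ℕ) (ℱ : Finset (Set T))
    (hcard : ℱ.card = n) (hinter : ∀ A ∈ ℱ, ∀ A' ∈ ℱ, A ∩ A' ∈ ℱ) :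
    ∃ A : ℕ → Set T, (∀ j < n, A j ∈ ℱ) ∧
      ∀ (𝒜 : Set (Set T)) (Q : Set T → Prop), (ℱ : Set (Set T)) ⊆ 𝒜 → IsAdditiveStable 𝒜 Q →
        (∀ i ≤ n, Q (⋃ j : Fin i, A j)) → ∀ D ∈ ℱ, Q D := by
  classical
  induction n generalizing ℱ with
  | zero =>
    rw [Finset.card_eq_zero] at hcard
    subst hcard
    exact ⟨fun _ => ∅, by simp, by simp⟩
  | succ n ih =>
    obtain ⟨M, hM⟩ := ℱ.exists_maximal (Finset.card_pos.1 (by omega))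
    have hinter' : ∀ A ∈ ℱ.erase M, ∀ A' ∈ ℱ, A ∩ A' ∈ ℱ.erase M := by
      intro A hA A' hA'
      rw [Finset.mem_erase] at hA ⊢
      refine ⟨fun h => hA.1 ?_, hinter A hA.2 A' hA'⟩
      have hMA : M ⊆ A := h ▸ inter_subset_left
      exact (hM.2 hA.2 hMA).antisymm hMA
    obtain ⟨A, hA, hAQ⟩ := ih (ℱ.erase M) (by rw [Finset.card_erase_of_mem hM.1]; omega)
      fun A hA A' hA' => hinter' A hA A' (Finset.mem_of_mem_erase hA')
    refine ⟨fun j => if j < n then A j else M, fun j _ => ?_, fun 𝒜 Q hℱ hQ h => ?_⟩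
    · dsimp only
      split_ifs with hj
      · exact Finset.mem_of_mem_erase (hA j hj)
      · exact hM.1
    have hpre : ∀ i ≤ n, Q (⋃ j : Fin i, A j) := by
      intro i hi
      have := h i (by omega)
      rwa [iUnion_congr fun j : Fin i => if_pos (j.2.trans_le hi)] at this
    have herase : ((ℱ.erase M : Finset (Set T)) : Set (Set T)) ⊆ 𝒜 := fun D hD =>
      hℱ (Finset.mem_of_mem_erase (Finset.mem_coe.1 hD))
    have hlower := hAQ 𝒜 Q herase hQ hpre
    intro D hD
    by_cases hDM : D = M
    · subst hDM
      refine hQ.of_union (⋃ j : Fin n, A j) ⟨n, _, fun j => herase (hA j j.2), rfl⟩ D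
        (mem_finUnions_of_mem (hℱ hD)) ?_ (hpre n le_rfl) ?_
      · have := h (n + 1) le_rfl
        rw [Fin.iUnion_castSucc_union_last] at this
        simpa using this
      · rw [iUnion_inter]
        exact hQ.of_mem_finUnions herase
          (fun A hA A' hA' => hinter' A hA A' (Finset.mem_of_mem_erase hA')) hlower
          ⟨n, _, fun j => hinter' _ (hA j j.2) D hD, rfl⟩
    · exact hlower D (Finset.mem_erase.2 ⟨hDM, hD⟩)

/-- `X_U` and `Y_U` are almost surely the same linear combination of values of the
corresponding process over `𝒱`. -/
def IsAESpanned {T Ω₁ Ω₂ : Type*} [MeasurableSpace Ω₁] [MeasurableSpace Ω₂]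
    (P₁ : Measure Ω₁) (P₂ : Measure Ω₂) (X : Set T → Ω₁ → ℝ) (Y : Set T → Ω₂ → ℝ)
    (𝒱 : Set (Set T)) (U : Set T) : Prop :=
  ∃ w ∈ Submodule.span ℝ (range fun V : 𝒱 => (X V, Y V)), X U =ᵐ[P₁] w.1 ∧ Y U =ᵐ[P₂] w.2

section IsAESpanned

variable {T Ω₁ Ω₂ : Type*} [MeasurableSpace Ω₁] [MeasurableSpace Ω₂]
  {P₁ : Measure Ω₁} {P₂ : Measure Ω₂} {X : Set T → Ω₁ → ℝ} {Y : Set T → Ω₂ → ℝ}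
  {𝒱 : Set (Set T)}

theorem isAESpanned_of_mem {U : Set T} (hU : U ∈ 𝒱) : IsAESpanned P₁ P₂ X Y 𝒱 U :=
  ⟨(X U, Y U), Submodule.subset_span ⟨⟨U, hU⟩, rfl⟩, ae_eq_rfl, ae_eq_rfl⟩

theorem isAdditiveStable_isAESpanned {𝒜 : Set (Set T)} (hX : IsAdditiveProcess 𝒜 P₁ X)
    (hY : IsAdditiveProcess 𝒜 P₂ Y) : IsAdditiveStable 𝒜 (IsAESpanned P₁ P₂ X Y 𝒱) where
  empty := ⟨0, Submodule.zero_mem _, hX.1, hY.1⟩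
  union := by
    rintro U hU V hV ⟨u, hu, hu₁, hu₂⟩ ⟨v, hv, hv₁, hv₂⟩ ⟨w, hw, hw₁, hw₂⟩
    refine ⟨u + v - w, Submodule.sub_mem _ (Submodule.add_mem _ hu hv) hw, ?_, ?_⟩
    · filter_upwards [hX.2 U hU V hV, hu₁, hv₁, hw₁] with ω h h₁ h₂ h₃
      simp [h, h₁, h₂, h₃]
    · filter_upwards [hY.2 U hU V hV, hu₂, hv₂, hw₂] with ω h h₁ h₂ h₃
      simp [h, h₁, h₂, h₃]
  of_union := by
    rintro U hU V hV ⟨v, hv, hv₁, hv₂⟩ ⟨u, hu, hu₁, hu₂⟩ ⟨w, hw, hw₁, hw₂⟩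
    refine ⟨v - u + w, Submodule.add_mem _ (Submodule.sub_mem _ hv hu) hw, ?_, ?_⟩
    · filter_upwards [hX.2 U hU V hV, hu₁, hv₁, hw₁] with ω h h₁ h₂ h₃
      simp only [Pi.add_apply, Pi.sub_apply, Prod.fst_add, Prod.fst_sub, ← h₁, ← h₂, ← h₃, h]
      ring
    · filter_upwards [hY.2 U hU V hV, hu₂, hv₂, hw₂] with ω h h₁ h₂ h₃
      simp only [Pi.add_apply, Pi.sub_apply, Prod.snd_add, Prod.snd_sub, ← h₁, ← h₂, ← h₃, h]
      ring

theorem map_eq_map_of_isAESpanned (hX : ∀ U, Measurable (X U)) (hY : ∀ U, Measurable (Y U))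
    (h𝒱 : ∀ (n : ℕ) (V : Fin n → Set T), (∀ i, V i ∈ 𝒱) →
      Measure.map (fun ω (i : Fin n) => X (V i) ω) P₁
        = Measure.map (fun ω (i : Fin n) => Y (V i) ω) P₂)
    {n : ℕ} {U : Fin n → Set T} (hU : ∀ i, IsAESpanned P₁ P₂ X Y 𝒱 (U i)) :
    Measure.map (fun ω (i : Fin n) => X (U i) ω) P₁
      = Measure.map (fun ω (i : Fin n) => Y (U i) ω) P₂ := by
  classical
  choose w hw hwX hwY using hU
  simp only [Finsupp.mem_span_range_iff_exists_finsupp] at hw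
  choose c hc using hw
  let t : Finset 𝒱 := Finset.univ.biUnion fun i => (c i).support
  let e := t.equivFin
  let L : (Fin t.card → ℝ) → Fin n → ℝ := fun y i => ∑ k, c i (e.symm k) * y k
  have hL : Measurable L := by fun_prop
  have hwL : ∀ i, w i = ∑ k, c i (e.symm k) • (X ((e.symm k : 𝒱) : Set T), Y (e.symm k : 𝒱)) := by
    intro i
    rw [← hc i, Finsupp.sum_of_support_subset (s := t) _
      (Finset.subset_biUnion_of_mem (fun i => (c i).support) (Finset.mem_univ i)) _ (by simp),
      ← Finset.sum_coe_sort, ← e.symm.sum_comp]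
  have hXL : (fun ω i => X (U i) ω) =ᵐ[P₁]
      L ∘ fun ω k => X ((e.symm k : 𝒱) : Set T) ω := by
    filter_upwards [ae_all_iff.2 hwX] with ω h
    ext i
    rw [h i, hwL i]
    simp [L, Prod.fst_sum, Finset.sum_apply]
  have hYL : (fun ω i => Y (U i) ω) =ᵐ[P₂]
      L ∘ fun ω k => Y ((e.symm k : 𝒱) : Set T) ω := by
    filter_upwards [ae_all_iff.2 hwY] with ω h
    ext i
    rw [h i, hwL i]
    simp [L, Prod.snd_sum, Finset.sum_apply]
  rw [Measure.map_congr hXL, Measure.map_congr hYL,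
    ← Measure.map_map hL (measurable_pi_lambda _ fun k => hX _),
    ← Measure.map_map hL (measurable_pi_lambda _ fun k => hY _),
    h𝒱 _ (fun k => ((e.symm k : 𝒱) : Set T)) fun k => (e.symm k : 𝒱).2]

end IsAESpanned

theorem IsSimpleFlow.mem_finUnions {T : Type*} [TopologicalSpace T] {𝒜 : Set (Set T)} {a b : ℝ}
    {f : ℝ → Set T} (hf : IsSimpleFlow 𝒜 a b f) {s : ℝ} (hs : s ∈ Icc a b) :
    f s ∈ finUnions 𝒜 := by
  obtain ⟨n, t, g, hn, rfl, rfl, hlt, hg, hfg⟩ := hf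
  have hex : ∃ i, 1 ≤ i ∧ i ≤ n ∧ s ∈ Icc (t (i - 1)) (t i) := by
    classical
    have hP : ∃ i, 1 ≤ i ∧ s ≤ t i := ⟨n, hn, hs.2⟩
    obtain ⟨h1, h2⟩ := Nat.find_spec hP
    refine ⟨Nat.find hP, h1, Nat.find_min' hP ⟨hn, hs.2⟩, ?_, h2⟩
    rcases h1.eq_or_lt with h | h
    · rw [← h]
      exact hs.1
    · have := Nat.find_min hP (m := Nat.find hP - 1) (by omega)
      push Not at this
      exact (this (by omega)).le
  obtain ⟨i, h1, h2, hi⟩ := hex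
  have hend : ∀ j, 1 ≤ j → j ≤ n → g j (t j) ∈ 𝒜 := by
    intro j hj1 hj2
    have := hlt (j - 1) (by omega)
    rw [Nat.sub_add_cancel hj1] at this
    exact (hg j hj1 hj2).1 _ (right_mem_Icc.2 this.le)
  refine ⟨i, fun j => if (j : ℕ) = 0 then g i s else g j (t j), fun j => ?_, ?_⟩
  · dsimp only
    split_ifs with hj
    · exact (hg i h1 h2).1 s hi
    · exact hend j (by omega) (by omega)
  · rw [hfg i h1 h2 s hi]
    ext x
    simp only [mem_union, mem_iUnion, Finset.mem_Ico, exists_prop]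
    constructor
    · rintro (hx | ⟨j, hj, hx⟩)
      · exact ⟨⟨0, h1⟩, by simpa using hx⟩
      · exact ⟨⟨j, hj.2⟩, by simpa [show j ≠ 0 by omega] using hx⟩
    · rintro ⟨j, hx⟩
      split_ifs at hx with hj
      · exact .inl hx
      · exact .inr ⟨j, ⟨by omega, j.2⟩, hx⟩

/-- the finite-dimensional distributions of an additive `𝒜`-indexed
process determine and are determined by the finite-dimensional distributions of
its projections on simple flows. -/
theorem additive_fdd_eq_iff_simpleFlow_fdd_eq
    {T : Type*} [MetricSpace T] [LocallyCompactSpace T] [MeasurableSpace T] [BorelSpace T]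
    (I : IndexingCollection T) (m : Measure T) [m.Regular]
    {Ω₁ Ω₂ : Type*} [MeasurableSpace Ω₁] [MeasurableSpace Ω₂]
    (P₁ : Measure Ω₁) (P₂ : Measure Ω₂)
    [IsProbabilityMeasure P₁] [IsProbabilityMeasure P₂]
    (X : Set T → Ω₁ → ℝ) (Y : Set T → Ω₂ → ℝ)
    (hXmeas : ∀ U, Measurable (X U)) (hYmeas : ∀ U, Measurable (Y U))
    (hXadd : IsAdditiveProcess I.carrier P₁ X)
    (hYadd : IsAdditiveProcess I.carrier P₂ Y) :
    (∀ (n : ℕ) (U : Fin n → Set T), (∀ i, U i ∈ I.carrier) →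
        Measure.map (fun ω (i : Fin n) => X (U i) ω) P₁
          = Measure.map (fun ω (i : Fin n) => Y (U i) ω) P₂) ↔
    (∀ (a b : ℝ), a ≤ b → ∀ f : ℝ → Set T, IsSimpleFlow I.carrier a b f →
      ∀ (n : ℕ) (s : Fin n → ℝ), (∀ i, s i ∈ Icc a b) →
        Measure.map (fun ω (i : Fin n) => X (f (s i)) ω) P₁
          = Measure.map (fun ω (i : Fin n) => Y (f (s i)) ω) P₂) := by
  refine ⟨fun h a b _ f hf n s hs => ?_, fun h n U hU => ?_⟩
  · refine map_eq_map_of_isAESpanned hXmeas hYmeas h fun i => ?_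
    exact (isAdditiveStable_isAESpanned hXadd hYadd).of_mem_finUnions subset_rfl
      (fun A hA A' hA' => I.inter_mem hA hA') (fun A hA => isAESpanned_of_mem hA)
      (hf.mem_finUnions (hs i))
  · let 𝒮 := infClosure {A | A ∈ range U ∧ A.Nonempty}
    have hfin : 𝒮.Finite := ((finite_range U).subset fun A hA => hA.1).infClosure
    have hmem : 𝒮 ⊆ {A | A ∈ I.carrier ∧ A.Nonempty} := by
      refine infClosure_min ?_ fun A hA A' hA' =>
        ⟨I.inter_mem hA.1 hA'.1, I.inter_nonempty A hA.1 A' hA'.1 hA.2 hA'.2⟩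
      rintro _ ⟨⟨i, rfl⟩, hne⟩
      exact ⟨hU i, hne⟩
    have hinter : ∀ A ∈ hfin.toFinset, ∀ A' ∈ hfin.toFinset, A ∩ A' ∈ hfin.toFinset := by
      simp only [Finite.mem_toFinset]
      exact fun A hA A' hA' => infClosed_infClosure hA hA'
    obtain ⟨A, hA, hAQ⟩ :=
      exists_enumeration_forall_isAdditiveStable _ hfin.toFinset rfl hinter
    simp only [Finite.mem_toFinset] at hA hAQ
    obtain ⟨a, b, f, hab, hf, hfA⟩ := I.exists_simpleFlow A (fun j hj => (hmem (hA j hj)).1)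
      fun j hj => (hmem (hA j hj)).2
    have hstable := isAdditiveStable_isAESpanned (𝒱 := f '' Icc a b) hXadd hYadd
    refine map_eq_map_of_isAESpanned (𝒱 := f '' Icc a b) hXmeas hYmeas (fun k V hV => ?_)
      fun i => ?_
    · choose s hs hsV using hV
      simp only [← hsV]
      exact h a b hab f hf k s hs
    · rcases (U i).eq_empty_or_nonempty with he | hne
      · rw [he]
        exact hstable.empty
      · refine hAQ I.carrier _ (fun D hD => (hmem (hfin.mem_toFinset.1 hD)).1) hstable
          (fun k hk => ?_) (U i) (subset_infClosure ⟨⟨i, rfl⟩, hne⟩)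
        rcases k.eq_zero_or_pos with rfl | hk'
        · simpa using hstable.empty
        · obtain ⟨s, hs, hfs⟩ := hfA k hk' hk
          exact isAESpanned_of_mem ⟨s, hs, hfs⟩
end
end

section
/- Let 𝒜 be an indexing collection on a locally compact metric space T with Radon measure m (so every U ∈ 𝒜 is compact and m(U) < ∞), and suppose 𝒜 is totally ordered by inclusion. Then for every H ∈ (0, 1) a set-indexed fractional Brownian motion of index H on (T, 𝒜, m) exists: there are a probability space (Ω, ℱ, P) and a process X = {X_U : U ∈ 𝒜} of real random variables on Ω such that every finite real linear combination ∑ c_i X_{U_i} is a centered Gaussian random variable and E[X_U X_V] = ½ (m(U)^{2H} + m(V)^{2H} − m(U △ V)^{2H}) for all U, V ∈ 𝒜, where △ denotes symmetric difference. -/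
open Set MeasureTheory ProbabilityTheory Filter
open scoped NNReal ENNReal symmDiff

noncomputable section

theorem integral_exp_mul_I_lipschitz {Ω : Type*} [MeasurableSpace Ω] {P : Measure Ω}
    [IsProbabilityMeasure P] (t : ℝ) (f g : Lp ℝ 2 P) :
    ‖(∫ ω, Complex.exp (t * f ω * Complex.I) ∂P) - ∫ ω, Complex.exp (t * g ω * Complex.I) ∂P‖
      ≤ |t| * ‖f - g‖ := by
  have hint (f : Lp ℝ 2 P) : Integrable (fun ω ↦ Complex.exp (t * f ω * Complex.I)) P := by
    refine Integrable.of_bound (C := 1) ?_ (ae_of_all _ fun ω ↦ ?_)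
    · have := (Lp.stronglyMeasurable f).measurable
      exact Measurable.aestronglyMeasurable (by fun_prop)
    · rw [← Complex.ofReal_mul, Complex.norm_exp_ofReal_mul_I]
  have hL1 : ∫ ω, ‖(f - g) ω‖ ∂P ≤ ‖f - g‖ := by
    have h2 := Lp.memLp (f - g)
    have h1 : MemLp (f - g : Lp ℝ 2 P) 1 P := h2.mono_exponent one_le_two
    rw [Lp.norm_def, integral_norm_eq_lintegral_enorm h1.1, ← eLpNorm_one_eq_lintegral_enorm]
    exact ENNReal.toReal_mono h2.2.ne (eLpNorm_le_eLpNorm_of_exponent_le one_le_two h2.1)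
  rw [← integral_sub (hint f) (hint g)]
  calc _ ≤ ∫ ω, |t| * ‖(f - g) ω‖ ∂P := by
        refine norm_integral_le_of_norm_le
          ((((Lp.memLp (f - g)).mono_exponent one_le_two).integrable le_rfl).norm.const_mul _) ?_
        filter_upwards [Lp.coeFn_sub f g] with ω hω
        have : Complex.exp (t * f ω * Complex.I) - Complex.exp (t * g ω * Complex.I) =
            Complex.exp (((t * g ω : ℝ) : ℂ) * Complex.I) *
              (Complex.exp (Complex.I * ((t * (f ω - g ω) : ℝ) : ℂ)) - 1) := by
          rw [mul_sub, ← Complex.exp_add]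
          push_cast
          ring_nf
        rw [this, norm_mul, Complex.norm_exp_ofReal_mul_I, one_mul, hω, Pi.sub_apply,
          ← Real.norm_eq_abs, ← norm_mul]
        exact Real.norm_exp_I_mul_ofReal_sub_one_le
    _ ≤ |t| * ‖f - g‖ := by
        rw [integral_const_mul]
        gcongr

theorem charFun_map_Lp {Ω : Type*} [MeasurableSpace Ω] {P : Measure Ω} (f : Lp ℝ 2 P) (t : ℝ) :
    charFun (P.map f) t = ∫ ω, Complex.exp (t * f ω * Complex.I) ∂P := by
  rw [charFun_apply_real, integral_map (Lp.stronglyMeasurable f).measurable.aemeasurable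
    (Measurable.aestronglyMeasurable (by fun_prop))]

/-- Centered Gaussian elements of `L²` with variance their squared norm form a closed set. -/
theorem isClosed_setOf_map_eq_gaussianReal {Ω : Type*} [MeasurableSpace Ω] (P : Measure Ω)
    [IsProbabilityMeasure P] :
    IsClosed {f : Lp ℝ 2 P | P.map f = gaussianReal 0 (‖f‖₊ ^ 2)} := by
  have : {f : Lp ℝ 2 P | P.map f = gaussianReal 0 (‖f‖₊ ^ 2)} =
      ⋂ t : ℝ, {f : Lp ℝ 2 P | (∫ ω, Complex.exp (t * f ω * Complex.I) ∂P) =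
        Complex.exp (-(‖f‖ : ℂ) ^ 2 * t ^ 2 / 2)} := by
    ext f
    simp only [mem_ofPred_eq, mem_iInter, ← charFun_map_Lp]
    have key (t : ℝ) : charFun (gaussianReal 0 (‖f‖₊ ^ 2)) t =
        Complex.exp (-(‖f‖ : ℂ) ^ 2 * t ^ 2 / 2) := by
      rw [charFun_gaussianReal]
      congr 1
      push_cast
      simp
      ring
    have := Measure.isProbabilityMeasure_map (μ := P)
      (Lp.stronglyMeasurable f).measurable.aemeasurable
    exact ⟨fun h t ↦ by rw [h, key], fun h ↦ Measure.ext_of_charFun (by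
      ext t; rw [h, key])⟩
  rw [this]
  refine isClosed_iInter fun t ↦ isClosed_eq ?_ (by fun_prop)
  refine (LipschitzWith.of_dist_le_mul (K := ‖t‖₊) fun f g ↦ ?_).continuous
  rw [dist_eq_norm, dist_eq_norm]
  exact integral_exp_mul_I_lipschitz t f g

/-- Every real Hilbert space embeds isometrically into a space of centered Gaussian random
variables. -/
theorem exists_isonormal (E : Type) [NormedAddCommGroup E] [InnerProductSpace ℝ E]
    [CompleteSpace E] :
    ∃ (Ω : Type) (_ : MeasurableSpace Ω) (P : Measure Ω) (_ : IsProbabilityMeasure P)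
      (Φ : E →ₗᵢ[ℝ] Lp ℝ 2 P), ∀ h, P.map (Φ h) = gaussianReal 0 (‖h‖₊ ^ 2) := by
  obtain ⟨w, b, -⟩ := exists_hilbertBasis ℝ E
  let P : Measure (w → ℝ) := Measure.infinitePi fun _ ↦ gaussianReal 0 1
  have hlaw (i : w) : HasLaw (fun ω : w → ℝ ↦ ω i) (gaussianReal 0 1) P :=
    (measurePreserving_eval_infinitePi (fun _ : w ↦ gaussianReal 0 1) i).hasLaw
  have hgauss (i : w) : HasGaussianLaw (fun ω : w → ℝ ↦ ω i) P := (hlaw i).hasGaussianLaw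
  have hindep : iIndepFun (fun (i : w) (ω : w → ℝ) ↦ ω i) P :=
    iIndepFun_infinitePi (X := fun _ x ↦ x) fun _ ↦ measurable_id
  let e (i : w) : Lp ℝ 2 P := (hgauss i).memLp_two.toLp
  have he (i : w) : e i =ᵐ[P] fun ω ↦ ω i := MemLp.coeFn_toLp _
  have hmean (i : w) : ∫ ω, ω i ∂P = 0 := by
    rw [(hlaw i).integral_eq, integral_id_gaussianReal]
  have hinner (i j : w) : inner ℝ (e i) (e j) = ∫ ω, ω i * ω j ∂P := by
    rw [L2.inner_def]
    refine integral_congr_ae ?_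
    filter_upwards [he i, he j] with ω hi hj
    rw [hi, hj]
    simp [mul_comm]
  have hon : Orthonormal ℝ e := by
    classical
    rw [orthonormal_iff_ite]
    intro i j
    rw [hinner]
    split_ifs with hij
    · subst hij
      have := (hlaw i).variance_eq
      rw [variance_of_integral_eq_zero (hgauss i).aemeasurable (hmean i)] at this
      simpa [pow_two] using this
    · rw [(hindep.indepFun hij).integral_fun_mul_eq_mul_integral
        (hgauss i).aemeasurable.aestronglyMeasurable
        (hgauss j).aemeasurable.aestronglyMeasurable,
        hmean i, zero_mul]
  let Φ : E →ₗᵢ[ℝ] Lp ℝ 2 P :=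
    hon.orthogonalFamily.linearIsometry.comp b.repr.toLinearIsometry
  have hΦ (h : E) : HasSum (fun i ↦ b.repr h i • e i) (Φ h) := by
    exact hon.orthogonalFamily.hasSum_linearIsometry (b.repr h)
  refine ⟨w → ℝ, inferInstance, P, inferInstance, Φ, fun h ↦ ?_⟩
  rw [← Φ.nnnorm_map]
  obtain ⟨c, hc⟩ : ∃ c : w → ℝ, HasSum (fun i ↦ c i • e i) (Φ h) := ⟨_, hΦ h⟩
  refine (isClosed_setOf_map_eq_gaussianReal P).mem_of_tendsto hc (.of_forall fun s ↦ ?_)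
  set f : Lp ℝ 2 P := ∑ i ∈ s, c i • e i
  have hf : f =ᵐ[P] fun ω ↦ ∑ i : s, c i * ω i := by
    refine (Lp.coeFn_finsetSum _ _).trans ?_
    have : ∀ᵐ ω ∂P, ∀ i ∈ s, (c i • e i : Lp ℝ 2 P) ω = c i * ω i := by
      rw [Finset.eventually_all]
      intro i _
      filter_upwards [Lp.coeFn_smul (c i) (e i), he i] with ω h1 h2
      rw [h1, Pi.smul_apply, h2, smul_eq_mul]
    filter_upwards [this] with ω hω
    rw [Finset.sum_apply, Finset.sum_congr rfl hω, ← Finset.sum_coe_sort s]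
  have hfg : HasGaussianLaw f P := by
    refine HasGaussianLaw.congr (iIndepFun.hasGaussianLaw_fun_sum
      (fun i : s ↦ (hgauss i).fun_smul (c i)) ?_) hf.symm
    exact (iIndepFun_infinitePi (P := fun _ : w ↦ gaussianReal 0 1)
      (X := fun i x ↦ c i * x) fun _ ↦ by fun_prop).precomp Subtype.val_injective
  have hf0 : ∫ ω, f ω ∂P = 0 := by
    rw [integral_congr_ae hf, integral_finsetSum _ fun (i : s) _ ↦
      (hgauss i).integrable.const_mul (c i)]
    exact Finset.sum_eq_zero fun i _ ↦ by rw [integral_const_mul, hmean, mul_zero]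
  have hfv : Var[f; P] = ‖f‖ ^ 2 := by
    rw [variance_of_integral_eq_zero hfg.aemeasurable hf0, ← real_inner_self_eq_norm_sq,
      L2.inner_def]
    simp [pow_two]
  rw [mem_ofPred_eq, hfg.map_eq_gaussianReal, hf0, hfv]
  congr
  rw [Real.toNNReal_pow (norm_nonneg f), norm_toNNReal]

theorem norm_exp_I_sub_one_le_two (x : ℝ) : ‖Complex.exp (Complex.I * x) - 1‖ ≤ 2 := by
  refine (norm_sub_le _ _).trans ?_
  rw [Complex.norm_exp_I_mul_ofReal, norm_one]
  norm_num

/-- The spectral density of fractional Brownian motion is integrable. -/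
theorem integrableOn_normSq_exp_sub_one_mul_rpow {H : ℝ} (hH : H ∈ Ioo (0 : ℝ) 1) :
    IntegrableOn (fun x : ℝ ↦ ‖Complex.exp (Complex.I * x) - 1‖ ^ 2 * x ^ (-(1 + 2 * H)))
      (Ioi 0) := by
  have hm : Measurable
      (fun x : ℝ ↦ ‖Complex.exp (Complex.I * x) - 1‖ ^ 2 * x ^ (-(1 + 2 * H))) := by fun_prop
  rw [← Ioc_union_Ioi_eq_Ioi zero_le_one]
  refine IntegrableOn.union ?_ ?_
  · have h : IntegrableOn (fun x : ℝ ↦ x ^ (1 - 2 * H)) (Ioc 0 1) := by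
      rw [← intervalIntegrable_iff_integrableOn_Ioc_of_le zero_le_one]
      exact intervalIntegral.intervalIntegrable_rpow' (by linarith [hH.2])
    refine h.mono' hm.aestronglyMeasurable ?_
    filter_upwards [ae_restrict_mem measurableSet_Ioc] with x hx
    have hx0 := hx.1
    have h1 := Real.norm_exp_I_mul_ofReal_sub_one_le (x := x)
    rw [Real.norm_of_nonneg (by positivity),
      show 1 - 2 * H = 2 + -(1 + 2 * H) by ring, Real.rpow_add hx0, Real.rpow_two]
    rw [Real.norm_of_nonneg hx0.le] at h1
    gcongr
  · have h : IntegrableOn (fun x : ℝ ↦ 2 ^ 2 * x ^ (-(1 + 2 * H))) (Ioi 1) :=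
      (integrableOn_Ioi_rpow_of_lt (by linarith [hH.1]) one_pos).const_mul _
    refine h.mono' hm.aestronglyMeasurable ?_
    filter_upwards [ae_restrict_mem measurableSet_Ioi] with x hx
    have hx0 : 0 < x := zero_lt_one.trans hx
    rw [Real.norm_of_nonneg (by positivity)]
    gcongr
    exact norm_exp_I_sub_one_le_two x

/-- The variance of the spectral representation of fractional Brownian motion at time one. -/
def fBmSpectralConst (H : ℝ) : ℝ :=
  ∫ x in Ioi (0 : ℝ), ‖Complex.exp (Complex.I * x) - 1‖ ^ 2 * x ^ (-(1 + 2 * H))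

theorem fBmSpectralConst_pos {H : ℝ} (hH : H ∈ Ioo (0 : ℝ) 1) : 0 < fBmSpectralConst H := by
  rw [fBmSpectralConst, setIntegral_pos_iff_support_of_nonneg_ae]
  · refine lt_of_lt_of_le ?_ (measure_mono (s := Ioo (0 : ℝ) 1) fun x hx ↦ ⟨?_, hx.1⟩)
    · simp
    · have h0 : (0 : ℝ) < x ^ (-(1 + 2 * H)) := Real.rpow_pos_of_pos hx.1 _
      have h1 : 0 < Real.sin (x / 2) :=
        Real.sin_pos_of_pos_of_lt_pi (by linarith [hx.1]) (by linarith [hx.2, Real.pi_gt_three])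
      rw [Function.mem_support, Complex.norm_exp_I_mul_ofReal_sub_one]
      rw [Real.norm_of_nonneg (by positivity)]
      positivity
  · filter_upwards [ae_restrict_mem measurableSet_Ioi] with x hx
    have : (0 : ℝ) < x := hx
    simp only [Pi.zero_apply]
    positivity
  · exact integrableOn_normSq_exp_sub_one_mul_rpow hH

theorem normSq_exp_mul_sub_one_mul_rpow {H t x : ℝ} (ht : 0 < t) (hx : 0 < x) :
    ‖Complex.exp (Complex.I * (t * x : ℝ)) - 1‖ ^ 2 * x ^ (-(1 + 2 * H)) =
      t ^ (1 + 2 * H) *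
        (‖Complex.exp (Complex.I * (t * x : ℝ)) - 1‖ ^ 2 * (t * x) ^ (-(1 + 2 * H))) := by
  rw [Real.mul_rpow ht.le hx.le, Real.rpow_neg ht.le]
  field_simp

theorem norm_exp_I_abs_sub_one (t x : ℝ) :
    ‖Complex.exp (Complex.I * (|t| * x : ℝ)) - 1‖ = ‖Complex.exp (Complex.I * (t * x : ℝ)) - 1‖ := by
  rw [Complex.norm_exp_I_mul_ofReal_sub_one, Complex.norm_exp_I_mul_ofReal_sub_one]
  rcases abs_choice t with h | h
  · rw [h]
  · rw [h, neg_mul, neg_div, Real.sin_neg, mul_neg, norm_neg]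

theorem integrableOn_normSq_exp_mul_sub_one_mul_rpow {H : ℝ} (hH : H ∈ Ioo (0 : ℝ) 1) (t : ℝ) :
    IntegrableOn (fun x : ℝ ↦ ‖Complex.exp (Complex.I * (t * x : ℝ)) - 1‖ ^ 2
      * x ^ (-(1 + 2 * H))) (Ioi 0) := by
  rcases eq_or_ne t 0 with rfl | ht
  · simp
  have ht' := abs_pos.2 ht
  have h := ((integrableOn_Ioi_comp_mul_left_iff
    (fun x : ℝ ↦ ‖Complex.exp (Complex.I * x) - 1‖ ^ 2 * x ^ (-(1 + 2 * H))) 0 ht').2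
      (by simpa using integrableOn_normSq_exp_sub_one_mul_rpow hH)).const_mul (|t| ^ (1 + 2 * H))
  refine IntegrableOn.congr_fun h (fun x hx ↦ ?_) measurableSet_Ioi
  simp only [← norm_exp_I_abs_sub_one t]
  exact (normSq_exp_mul_sub_one_mul_rpow ht' hx).symm

theorem integral_normSq_exp_mul_sub_one_mul_rpow {H : ℝ} (hH : H ∈ Ioo (0 : ℝ) 1) (t : ℝ) :
    ∫ x in Ioi (0 : ℝ), ‖Complex.exp (Complex.I * (t * x : ℝ)) - 1‖ ^ 2 * x ^ (-(1 + 2 * H)) =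
      fBmSpectralConst H * |t| ^ (2 * H) := by
  rcases eq_or_ne t 0 with rfl | ht
  · simp [Real.zero_rpow (mul_pos two_pos hH.1).ne']
  have ht' := abs_pos.2 ht
  simp only [← norm_exp_I_abs_sub_one t]
  rw [setIntegral_congr_fun measurableSet_Ioi fun x hx ↦ normSq_exp_mul_sub_one_mul_rpow ht' hx,
    integral_const_mul, integral_comp_mul_left_Ioi
      (fun x : ℝ ↦ ‖Complex.exp (Complex.I * x) - 1‖ ^ 2 * x ^ (-(1 + 2 * H))) 0 ht', mul_zero,
    ← fBmSpectralConst, Real.rpow_add ht', Real.rpow_one, smul_eq_mul]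
  field_simp

/-- The spectral kernel of fractional Brownian motion. -/
def fBmKernel (H t x : ℝ) : ℂ :=
  (Complex.exp (Complex.I * (t * x : ℝ)) - 1) * (x ^ (-(1 / 2 + H)) : ℝ)

theorem norm_fBmKernel_sub_sq {H s t x : ℝ} (hx : 0 < x) :
    ‖fBmKernel H s x - fBmKernel H t x‖ ^ 2 =
      ‖Complex.exp (Complex.I * ((s - t) * x : ℝ)) - 1‖ ^ 2 * x ^ (-(1 + 2 * H)) := by
  have : fBmKernel H s x - fBmKernel H t x = Complex.exp (Complex.I * (t * x : ℝ)) *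
      (Complex.exp (Complex.I * ((s - t) * x : ℝ)) - 1) * (x ^ (-(1 / 2 + H)) : ℝ) := by
    rw [fBmKernel, fBmKernel, mul_sub, ← Complex.exp_add]
    push_cast
    ring_nf
  rw [this, norm_mul, norm_mul, Complex.norm_exp_I_mul_ofReal, one_mul, mul_pow,
    Complex.norm_real, Real.norm_of_nonneg (by positivity), ← Real.rpow_mul_natCast hx.le]
  congr 2
  push_cast
  ring

theorem fBmKernel_zero (H x : ℝ) : fBmKernel H 0 x = 0 := by simp [fBmKernel]

theorem memLp_fBmKernel {H : ℝ} (hH : H ∈ Ioo (0 : ℝ) 1) (t : ℝ) :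
    MemLp (fBmKernel H t) 2 (volume.restrict (Ioi 0)) := by
  have hm : Measurable (fBmKernel H t) := by unfold fBmKernel; fun_prop
  rw [memLp_two_iff_integrable_sq_norm hm.aestronglyMeasurable]
  refine (integrableOn_normSq_exp_mul_sub_one_mul_rpow hH t).congr_fun
    (fun x hx ↦ ?_) measurableSet_Ioi
  simpa [fBmKernel_zero] using (norm_fBmKernel_sub_sq (H := H) (s := t) (t := 0) hx).symm

/-- The snowflaked real line `(ℝ, |s - t| ^ H)` embeds isometrically into a Hilbert space. -/
theorem exists_norm_sub_sq_eq_abs_rpow {H : ℝ} (hH : H ∈ Ioo (0 : ℝ) 1) :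
    ∃ h : ℝ → Lp ℂ 2 (volume.restrict (Ioi (0 : ℝ))),
      h 0 = 0 ∧ ∀ s t, ‖h s - h t‖ ^ 2 = |s - t| ^ (2 * H) := by
  have hC := fBmSpectralConst_pos hH
  refine ⟨fun t ↦ (√(fBmSpectralConst H))⁻¹ • (memLp_fBmKernel hH t).toLp, ?_, fun s t ↦ ?_⟩
  · have h0 : (memLp_fBmKernel hH 0).toLp = 0 := by
      rw [Lp.eq_zero_iff_ae_eq_zero]
      filter_upwards [(memLp_fBmKernel hH 0).coeFn_toLp] with x hx
      rw [hx, fBmKernel_zero, Pi.zero_apply]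
    simp only [h0, smul_zero]
  · have hnorm : ‖(memLp_fBmKernel hH s).toLp - (memLp_fBmKernel hH t).toLp‖ ^ 2 =
        fBmSpectralConst H * |s - t| ^ (2 * H) := by
      rw [← integral_normSq_exp_mul_sub_one_mul_rpow hH, ← MemLp.toLp_sub,
        ← real_inner_self_eq_norm_sq, L2.inner_def]
      refine integral_congr_ae ?_
      filter_upwards [((memLp_fBmKernel hH s).sub (memLp_fBmKernel hH t)).coeFn_toLp,
        ae_restrict_mem measurableSet_Ioi] with x hx hx0
      rw [hx, real_inner_self_eq_norm_sq, Pi.sub_apply, norm_fBmKernel_sub_sq hx0]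
    rw [← smul_sub, norm_smul, mul_pow, hnorm, norm_inv, Real.norm_of_nonneg (Real.sqrt_nonneg _),
      inv_pow, Real.sq_sqrt hC.le, inv_mul_cancel_left₀ hC.ne']

theorem toReal_measure_symmDiff_of_chain {T : Type*} [MeasurableSpace T] {m : Measure T}
    {U V : Set T} (hU : MeasurableSet U) (hV : MeasurableSet V) (hmU : m U ≠ ∞) (hmV : m V ≠ ∞)
    (h : U ⊆ V ∨ V ⊆ U) : (m (U ∆ V)).toReal = |(m U).toReal - (m V).toReal| := by
  wlog hUV : U ⊆ V generalizing U V
  · rw [symmDiff_comm, abs_sub_comm]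
    exact this hV hU hmV hmU h.symm (h.resolve_left hUV)
  rw [symmDiff_of_le hUV, measure_sdiff hUV hU.nullMeasurableSet hmU,
    ENNReal.toReal_sub_of_le (measure_mono hUV) hmV,
    abs_sub_comm, abs_of_nonneg]
  exact sub_nonneg.2 (ENNReal.toReal_mono hmV (measure_mono hUV))

/-- if the indexing collection `𝒜` is totally ordered by inclusion,
then for every `H ∈ (0, 1)` a set-indexed fractional Brownian motion of index `H`
on `(T, 𝒜, m)` exists on some probability space. -/
theorem exists_sifBm_of_chain
    {T : Type*} [MetricSpace T] [LocallyCompactSpace T] [MeasurableSpace T] [BorelSpace T]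
    (I : IndexingCollection T) (m : Measure T) [m.Regular]
    (hchain : ∀ U ∈ I.carrier, ∀ V ∈ I.carrier, U ⊆ V ∨ V ⊆ U)
    {H : ℝ} (hH : H ∈ Ioo (0 : ℝ) 1) :
    ∃ (Ω : Type) (_ : MeasurableSpace Ω) (P : Measure Ω),
      IsProbabilityMeasure P ∧
      ∃ X : Set T → Ω → ℝ, (∀ U ∈ I.carrier, Measurable (X U)) ∧
        IsSifBm I.carrier m H P X := by
  obtain ⟨h, h0, hdist⟩ := exists_norm_sub_sq_eq_abs_rpow hH
  obtain ⟨Ω, _, P, hP, Φ, hΦ⟩ := exists_isonormal (Lp ℂ 2 (volume.restrict (Ioi (0 : ℝ))))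
  refine ⟨Ω, _, P, hP, fun U ↦ Φ (h (m U).toReal),
    fun U _ ↦ (Lp.stronglyMeasurable _).measurable, fun n U c _ ↦ ?_, fun U hU V hV ↦ ?_⟩
  · refine ⟨_, Eq.trans (Measure.map_congr ?_) (hΦ (∑ i, c i • h (m (U i)).toReal))⟩
    rw [map_sum]
    refine EventuallyEq.trans ?_ (Lp.coeFn_finsetSum _ _).symm
    have : ∀ᵐ ω ∂P, ∀ i, Φ (c i • h (m (U i)).toReal) ω = c i * Φ (h (m (U i)).toReal) ω := by
      refine ae_all_iff.2 fun i ↦ ?_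
      rw [map_smul]
      filter_upwards [Lp.coeFn_smul (c i) (Φ (h (m (U i)).toReal))] with ω hω
      rw [hω, Pi.smul_apply, smul_eq_mul]
    filter_upwards [this] with ω hω
    simp only [Finset.sum_apply, hω]
  · have hcU := I.isCompact_mem U hU
    have hcV := I.isCompact_mem V hV
    have hinner := Φ.inner_map_map (h (m U).toReal) (h (m V).toReal)
    rw [L2.inner_def] at hinner
    have hnorm (t : ℝ) (ht : 0 ≤ t) : ‖h t‖ ^ 2 = t ^ (2 * H) := by
      simpa [h0, abs_of_nonneg ht] using hdist t 0
    rw [toReal_measure_symmDiff_of_chain hcU.isClosed.measurableSet hcV.isClosed.measurableSet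
      hcU.measure_ne_top hcV.measure_ne_top (hchain U hU V hV), ← hdist,
      ← hnorm _ ENNReal.toReal_nonneg, ← hnorm _ ENNReal.toReal_nonneg]
    rw [norm_sub_sq_real, ← hinner]
    simp only [RCLike.inner_apply, conj_trivial, mul_comm]
    ring
end
end

section
/- Let 𝒜 be an indexing collection on a locally compact metric space T with Radon measure m, let H ∈ (0, 1/2], and let B^H be a set-indexed fractional Brownian motion of index H on (T, 𝒜, m). Then B^H has m-stationary 𝒞₀-increments: for every n ≥ 1, every V ∈ 𝒜, and all increasing sequences U_1 ⊆ U_2 ⊆ … ⊆ U_n and A_1 ⊆ A_2 ⊆ … ⊆ A_n in 𝒜 with V ⊆ U_1 and m(U_i \ V) = m(A_i) for every i, the random vectors (B^H_{U_1} − B^H_V, …, B^H_{U_n} − B^H_V) and (B^H_{A_1}, …, B^H_{A_n}) have the same distribution. -/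
open Set MeasureTheory ProbabilityTheory Filter
open scoped NNReal ENNReal symmDiff

noncomputable section

theorem map_pi_eq_of_map_linearCombination_eq {Ω ι : Type*} [MeasurableSpace Ω] [Fintype ι]
    {P : Measure Ω} [IsFiniteMeasure P] {Y Z : ι → Ω → ℝ}
    (hY : ∀ i, Measurable (Y i)) (hZ : ∀ i, Measurable (Z i))
    (h : ∀ c : ι → ℝ, P.map (fun ω => ∑ i, c i * Y i ω) = P.map (fun ω => ∑ i, c i * Z i ω)) :
    P.map (fun ω i => Y i ω) = P.map (fun ω i => Z i ω) := by
  classical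
  have hmeas {W : ι → Ω → ℝ} (hW : ∀ i, Measurable (W i)) : Measurable fun ω i => W i ω :=
    measurable_pi_lambda _ hW
  apply Measure.ext_of_charFunDual
  ext L
  rw [charFunDual_eq_charFun_map_one, charFunDual_eq_charFun_map_one,
    Measure.map_map L.continuous.measurable (hmeas hY),
    Measure.map_map L.continuous.measurable (hmeas hZ)]
  have hL (W : ι → Ω → ℝ) :
      L ∘ (fun ω i => W i ω) = fun ω => ∑ i, L (Pi.single i 1) * W i ω := by
    funext ω
    rw [Function.comp_apply, ← ContinuousLinearMap.coe_coe, LinearMap.pi_apply_eq_sum_univ]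
    refine Finset.sum_congr rfl fun i _ => ?_
    rw [smul_eq_mul, mul_comm]
    congr 2
    ext j
    simp [Pi.single_apply, eq_comm]
  rw [hL, hL, h]

theorem IsCenteredGaussianRV.memLp_two {Ω : Type*} [MeasurableSpace Ω] {P : Measure Ω}
    {Y : Ω → ℝ} (h : IsCenteredGaussianRV P Y) (hY : AEMeasurable Y P) : MemLp Y 2 P := by
  obtain ⟨v, hv⟩ := h
  have h2 : MemLp id 2 (P.map Y) := hv ▸ memLp_id_gaussianReal 2
  exact (memLp_map_measure_iff aestronglyMeasurable_id hY).1 h2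

theorem integral_sq_eq_of_map_eq_gaussianReal {Ω : Type*} [MeasurableSpace Ω] {P : Measure Ω}
    {Y : Ω → ℝ} (hY : AEMeasurable Y P) {v : ℝ≥0} (h : P.map Y = gaussianReal 0 v) :
    ∫ ω, Y ω ^ 2 ∂P = v := by
  rw [← variance_id_gaussianReal (μ := 0) (v := v),
    variance_of_integral_eq_zero aemeasurable_id (by simp), ← h,
    integral_map hY (by fun_prop)]
  simp

theorem IsCenteredGaussianRV.map_eq_of_integral_sq_eq {Ω : Type*} [MeasurableSpace Ω]
    {P : Measure Ω} {Y Z : Ω → ℝ}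
    (hY : IsCenteredGaussianRV P Y) (hZ : IsCenteredGaussianRV P Z)
    (hYm : AEMeasurable Y P) (hZm : AEMeasurable Z P)
    (h : ∫ ω, Y ω ^ 2 ∂P = ∫ ω, Z ω ^ 2 ∂P) : P.map Y = P.map Z := by
  obtain ⟨v, hv⟩ := hY
  obtain ⟨w, hw⟩ := hZ
  rw [integral_sq_eq_of_map_eq_gaussianReal hYm hv,
    integral_sq_eq_of_map_eq_gaussianReal hZm hw] at h
  rw [hv, hw, NNReal.coe_injective h]

theorem integral_sq_sum_mul {Ω ι : Type*} [MeasurableSpace Ω] [Fintype ι] {P : Measure Ω}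
    {Y : ι → Ω → ℝ} (hY : ∀ i, MemLp (Y i) 2 P) (c : ι → ℝ) :
    ∫ ω, (∑ i, c i * Y i ω) ^ 2 ∂P = ∑ i, ∑ j, c i * c j * ∫ ω, Y i ω * Y j ω ∂P := by
  have hprod (i j : ι) : Integrable (fun ω => c i * c j * (Y i ω * Y j ω)) P :=
    ((hY i).integrable_mul (hY j)).const_mul _
  have hexp (ω : Ω) :
      (∑ i, c i * Y i ω) ^ 2 = ∑ i, ∑ j, c i * c j * (Y i ω * Y j ω) := by
    rw [sq, Finset.sum_mul_sum]
    exact Finset.sum_congr rfl fun i _ => Finset.sum_congr rfl fun j _ => by ring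
  simp_rw [hexp]
  rw [integral_finsetSum _ fun i _ => integrable_finsetSum _ fun j _ => hprod i j]
  refine Finset.sum_congr rfl fun i _ => ?_
  rw [integral_finsetSum _ fun j _ => hprod i j]
  simp_rw [integral_const_mul]

theorem measure_symmDiff_eq_of_measure_diff_eq {T : Type*} [MeasurableSpace T] {m : Measure T}
    {V U U' A A' : Set T} (hV : MeasurableSet V) (hU : MeasurableSet U) (hA : MeasurableSet A)
    (hUV : m (U \ V) ≠ ∞) (hVU : V ⊆ U) (hUU' : U ⊆ U') (hAA' : A ⊆ A')
    (h : m (U \ V) = m A) (h' : m (U' \ V) = m A') : m (U ∆ U') = m (A ∆ A') := by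
  rw [symmDiff_of_le hUU', symmDiff_of_le hAA', measure_sdiff hAA' hA.nullMeasurableSet (h ▸ hUV),
    ← h, ← h', ← measure_sdiff (sdiff_subset_sdiff_left hUU') (hU.diff hV).nullMeasurableSet hUV,
    sdiff_sdiff_right, inter_comm]
  congr 1
  ext x
  have := @hVU x
  simp only [Set.mem_sdiff, mem_union, mem_inter_iff]
  tauto

theorem IsSifBm.memLp_two {T Ω : Type*} [MeasurableSpace T] [MeasurableSpace Ω]
    {𝒜 : Set (Set T)} {m : Measure T} {H : ℝ} {P : Measure Ω} {X : Set T → Ω → ℝ}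
    (hX : IsSifBm 𝒜 m H P X) {U : Set T} (hU : U ∈ 𝒜) (hUm : AEMeasurable (X U) P) :
    MemLp (X U) 2 P := by
  refine IsCenteredGaussianRV.memLp_two ?_ hUm
  simpa using hX.1 1 (fun _ => U) (fun _ => 1) fun _ => hU

/-- The covariance of two increments from a common set `V` only involves the
measures of the symmetric differences. -/
theorem IsSifBm.integral_increment_mul_increment {T Ω : Type*} [MeasurableSpace T]
    [MeasurableSpace Ω] {𝒜 : Set (Set T)} {m : Measure T} {H : ℝ} (hH : H ≠ 0) {P : Measure Ω}
    {X : Set T → Ω → ℝ} (hXm : ∀ U ∈ 𝒜, Measurable (X U)) (hX : IsSifBm 𝒜 m H P X)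
    {U U' V : Set T} (hU : U ∈ 𝒜) (hU' : U' ∈ 𝒜) (hV : V ∈ 𝒜) :
    ∫ ω, (X U ω - X V ω) * (X U' ω - X V ω) ∂P =
      (1 / 2) * ((m (U ∆ V)).toReal ^ (2 * H) + (m (U' ∆ V)).toReal ^ (2 * H)
        - (m (U ∆ U')).toReal ^ (2 * H)) := by
  have hprod {S S' : Set T} (hS : S ∈ 𝒜) (hS' : S' ∈ 𝒜) :
      Integrable (fun ω => X S ω * X S' ω) P :=
    (hX.memLp_two hS (hXm S hS).aemeasurable).integrable_mul
      (hX.memLp_two hS' (hXm S' hS').aemeasurable)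
  have hexp (ω : Ω) : (X U ω - X V ω) * (X U' ω - X V ω) =
      X U ω * X U' ω - X U ω * X V ω - X U' ω * X V ω + X V ω * X V ω := by ring
  simp_rw [hexp]
  have hsub1 : Integrable (fun ω => X U ω * X U' ω - X U ω * X V ω) P :=
    (hprod hU hU').sub (hprod hU hV)
  have hsub2 :
      Integrable (fun ω => X U ω * X U' ω - X U ω * X V ω - X U' ω * X V ω) P :=
    hsub1.sub (hprod hU' hV)
  rw [integral_add hsub2 (hprod hV hV),
    integral_sub hsub1 (hprod hU' hV),
    integral_sub (hprod hU hU') (hprod hU hV),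
    hX.2 U hU U' hU', hX.2 U hU V hV, hX.2 U' hU' V hV, hX.2 V hV V hV, symmDiff_self]
  simp only [bot_eq_empty, measure_empty, ENNReal.toReal_zero,
    Real.zero_rpow (mul_ne_zero two_ne_zero hH)]
  ring

/-- the set-indexed fractional Brownian motion of index
`H ∈ (0, 1/2]` has `m`-stationary `𝒞₀`-increments. -/
theorem sifBm_hasMStationaryC0Increments
    {T : Type*} [MetricSpace T] [LocallyCompactSpace T] [MeasurableSpace T] [BorelSpace T]
    (I : IndexingCollection T) (m : Measure T) [m.Regular]
    {Ω : Type*} [MeasurableSpace Ω] (P : Measure Ω) [IsProbabilityMeasure P]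
    {H : ℝ} (hH : H ∈ Ioc (0 : ℝ) (1 / 2))
    (X : Set T → Ω → ℝ) (hXmeas : ∀ U ∈ I.carrier, Measurable (X U))
    (hX : IsSifBm I.carrier m H P X) :
    HasMStationaryC0Increments I.carrier m P X := by
  intro n V hV U A hU hA hUmono hAmono hVU hm
  have hH0 : H ≠ 0 := hH.1.ne'
  have hmeas {S : Set T} (hS : S ∈ I.carrier) : MeasurableSet S :=
    (I.isCompact_mem S hS).measurableSet
  have hL2 {S : Set T} (hS : S ∈ I.carrier) : MemLp (X S) 2 P :=
    hX.memLp_two hS (hXmeas S hS).aemeasurable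
  have hYL2 (i : Fin n) : MemLp (fun ω => X (U i) ω - X V ω) 2 P :=
    (hL2 (hU i)).sub (hL2 hV)
  have hYm (i : Fin n) : Measurable fun ω => X (U i) ω - X V ω :=
    (hXmeas _ (hU i)).sub (hXmeas V hV)
  have hZm (i : Fin n) : Measurable (X (A i)) := hXmeas _ (hA i)
  have hdiff (i : Fin n) : m (U i ∆ V) = m (A i) := by
    rw [symmDiff_of_ge (hVU i), hm i]
  have hsymm_of_le {i j : Fin n} (hij : i ≤ j) : m (U i ∆ U j) = m (A i ∆ A j) :=
    measure_symmDiff_eq_of_measure_diff_eq (hmeas hV) (hmeas (hU i)) (hmeas (hA i))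
      (measure_ne_top_of_subset sdiff_subset (I.isCompact_mem _ (hU i)).measure_ne_top)
      (hVU i) (hUmono i j hij) (hAmono i j hij) (hm i) (hm j)
  have hsymm (i j : Fin n) : m (U i ∆ U j) = m (A i ∆ A j) := by
    rcases le_total i j with hij | hji
    · exact hsymm_of_le hij
    · rw [symmDiff_comm (U i), symmDiff_comm (A i), hsymm_of_le hji]
  refine map_pi_eq_of_map_linearCombination_eq hYm hZm fun c => ?_
  have hYgauss : IsCenteredGaussianRV P fun ω => ∑ i, c i * (X (U i) ω - X V ω) := by
    convert hX.1 (n + 1) (Fin.cons V U) (Fin.cons (-∑ i, c i) c)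
      (Fin.forall_fin_succ.2 ⟨hV, hU⟩) using 2 with ω
    simp only [Fin.sum_univ_succ, Fin.cons_zero, Fin.cons_succ, mul_sub, Finset.sum_sub_distrib,
      ← Finset.sum_mul]
    ring
  have hmeas_sum {W : Fin n → Ω → ℝ} (hW : ∀ i, Measurable (W i)) :
      AEMeasurable (fun ω => ∑ i, c i * W i ω) P :=
    (Finset.measurable_fun_sum _ fun i _ => (hW i).const_mul (c i)).aemeasurable
  refine hYgauss.map_eq_of_integral_sq_eq (hX.1 n A c hA) (hmeas_sum hYm) (hmeas_sum hZm) ?_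
  rw [integral_sq_sum_mul hYL2 c,
    integral_sq_sum_mul (fun i => hL2 (hA i)) c]
  refine Finset.sum_congr rfl fun i _ => Finset.sum_congr rfl fun j _ => ?_
  rw [hX.integral_increment_mul_increment hH0 hXmeas (hU i) (hU j) hV,
    hX.2 _ (hA i) _ (hA j), hdiff, hdiff, hsymm]
end
end
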